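/- (Free Paul Lévy theorem.) Let (M,τ) be a tracial noncommutative probability space with an increasing filtration of von Neumann algebras B_s, B ⊂ B_0, and let Z_s = (Z_s^1,…,Z_s^n), s ∈ ℝ₊, be an n-tuple of self-adjoint processes adapted to this filtration with Z_0 = 0 such that: (1) τ(Z_t | B_s) = Z_s for s ≤ t; (2) Z_t − Z_s = U_{t,s} + V_{t,s} with τ(|U_{t,s}|⁴) ≤ K(t−s)^{3/2} and τ(|V_{t,s}|²) ≤ K(t−s)²; (3) τ(Z_t^k A Z_t^l B) = τ(Z_s^k A Z_s^l B) + (t−s)τ(A η_{lk}(E_B(B))) + o(t−s) for all A, B ∈ B_s. Then Z is a B-free Brownian motion of covariance η. -/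

import Mathlib

open Filter Topology MeasureTheory
open scoped ENNReal NNReal

noncomputable section

/-- A faithful tracial state on a unital complex C*-algebra.  This stands for a finite
von Neumann algebra `M` equipped with a faithful normal tracial state `τ`
(the `W*`-probability space `(M,τ)` of the paper). -/
structure TracialState (M : Type*) [NormedRing M] [StarRing M] [CStarRing M]
    [NormedAlgebra ℂ M] [StarModule ℂ M] [CompleteSpace M] where
  τ : M →ₗ[ℂ] ℂ
  τ_one : τ 1 = 1
  τ_tracial : ∀ a b : M, τ (a * b) = τ (b * a)
  τ_pos_re : ∀ a : M, 0 ≤ (τ (star a * a)).re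
  τ_pos_im : ∀ a : M, (τ (star a * a)).im = 0
  τ_star : ∀ a : M, τ (star a) = starRingEnd ℂ (τ a)
  τ_faithful : ∀ a : M, τ (star a * a) = 0 → a = 0

namespace TracialState

variable {M : Type*} [NormedRing M] [StarRing M] [CStarRing M]
  [NormedAlgebra ℂ M] [StarModule ℂ M] [CompleteSpace M]

/-- the `L²`-norm `‖x‖₂ = τ(x^*x)^{1/2}` associated to a trace. -/
def norm2 (ρ : TracialState M) (x : M) : ℝ := Real.sqrt (ρ.τ (star x * x)).re

end TracialState

section FreeProbability

variable {A : Type*} [Ring A] [Algebra ℂ A] {ι : Type*}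

/-- the word `b₀ · S_{i₁} b₁ · S_{i₂} b₂ ⋯ S_{iₙ} bₙ` determined by a leading
coefficient `b₀` and a list of letters `(i₁,b₁), …, (iₙ,bₙ)`. -/
def wprod (S : ι → A) (b : A) (w : List (ι × A)) : A :=
  b * (w.map fun p => S p.1 * p.2).prod

/-- A family `(S_i)_{i ∈ ι}` is a *`B`-valued semicircular (B-Gaussian) family* with
covariance `η : ι → ι → (B → B)` relative to the conditional expectation `E` onto the
subalgebra `Bset`, in the sense of Speicher and Shlyakhtenko: the operator-valued
moments obey the free Wick recursion
`E(b₀ S_i b₁ S_{i₁} b₂ ⋯ S_{iₙ} bₙ)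
  = ∑_k b₀ · η_{i i_k}(E(b₁ S_{i₁} ⋯ b_{k-1})) · E(b_k S_{i_{k+1}} ⋯ bₙ)`
for all coefficients in `Bset`. -/
def IsSemicircularFamily (E : A →ₗ[ℂ] A) (Bset : Set A)
    (η : ι → ι → (A →ₗ[ℂ] A)) (S : ι → A) : Prop :=
  ∀ (i : ι) (b₀ b₁ : A) (w : List (ι × A)), b₀ ∈ Bset → b₁ ∈ Bset →
    (∀ p ∈ w, p.2 ∈ Bset) →
    E (b₀ * S i * wprod S b₁ w) =
      ∑ k : Fin w.length,
        b₀ * η i (w.get k).1 (E (wprod S b₁ (w.take (k : ℕ))))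
          * E (wprod S (w.get k).2 (w.drop ((k : ℕ) + 1)))

/-- An *adapted `B`-free Brownian motion of covariance `η`*: a family of self-adjoint
processes `Z^1, …, Z^n`, adapted to the filtration `Bfil`, vanishing at `0`, such that
for every `t ≥ 0` the increment family `(Z_s^j − Z_t^j)_{s ≥ t, j}` is a `B_t`-valued
semicircular family (relative to the conditional expectation `Efam t` onto `Bfil t`)
with covariance `E_{B_t}((Z_s^i − Z_t^i) b (Z_u^j − Z_t^j)) = ((s∧u)−t) η_{ij}(E_B(b))`. -/
def IsBFreeBrownianMotion [StarRing A] {n : ℕ} (Efam : ℝ → (A →ₗ[ℂ] A))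
    (Bfil : ℝ → Set A) (EB : A →ₗ[ℂ] A) (η : Fin n → Fin n → (A →ₗ[ℂ] A))
    (Z : ℝ → Fin n → A) : Prop :=
  (∀ j, Z 0 j = 0) ∧
  (∀ t, 0 ≤ t → ∀ j, Z t j ∈ Bfil t ∧ star (Z t j) = Z t j) ∧
  ∀ t, 0 ≤ t →
    IsSemicircularFamily (Efam t) (Bfil t)
      (fun p q : {s : ℝ // t ≤ s} × Fin n =>
        (((min (p.1 : ℝ) (q.1 : ℝ) - t : ℝ) : ℂ) • ((η p.2 q.2).comp EB)))
      (fun p : {s : ℝ // t ≤ s} × Fin n => Z (p.1 : ℝ) p.2 - Z t p.2)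

end FreeProbability

section ReflectPow

variable {A : Type*} [Ring A] [StarRing A]

/-- `y_j` for `y_0 = x`, `y_{j+1} = y_j y_j^*`. -/
def reflectPow (x : A) : ℕ → A
  | 0 => x
  | j + 1 => reflectPow x j * star (reflectPow x j)

theorem reflectPow_succ_eq (x : A) (j : ℕ) : reflectPow x (j + 1) = (x * star x) ^ 2 ^ j := by
  induction j with
  | zero => simp [reflectPow]
  | succ j ih =>
    have : star (reflectPow x (j + 1)) = reflectPow x (j + 1) := by simp [reflectPow]
    rw [reflectPow, this, ih, ← pow_add, pow_succ, mul_two]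

theorem List.prod_map_star_reverse (l : List A) : (l.map star).reverse.prod = star l.prod := by
  induction l with
  | nil => simp
  | cons a l ih => simp [ih]

end ReflectPow

section PositiveTrace

variable {A : Type*} [Ring A] [Algebra ℂ A] [StarRing A]

/-- A positive tracial functional on a star algebra. -/
structure IsPosTrace (τ : A →ₗ[ℂ] ℂ) : Prop where
  comm : ∀ a b : A, τ (a * b) = τ (b * a)
  pos : ∀ a : A, 0 ≤ (τ (star a * a)).re ∧ (τ (star a * a)).im = 0

/-- The `L²`-seminorm of a positive tracial functional. -/
def traceNorm (τ : A →ₗ[ℂ] ℂ) (x : A) : ℝ := √(τ (star x * x)).re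

namespace IsPosTrace

variable {τ : A →ₗ[ℂ] ℂ}

theorem sq_traceNorm (hτ : IsPosTrace τ) (x : A) :
    traceNorm τ x ^ 2 = ‖τ (star x * x)‖ := by
  have h := hτ.pos x
  rw [traceNorm, Real.sq_sqrt h.1, ← Complex.abs_re_eq_norm.2 h.2, abs_of_nonneg h.1]

theorem traceNorm_nonneg (x : A) : 0 ≤ traceNorm τ x := Real.sqrt_nonneg _

theorem traceNorm_star (hτ : IsPosTrace τ) (x : A) : traceNorm τ (star x) = traceNorm τ x := by
  rw [traceNorm, traceNorm, star_star, hτ.comm]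

theorem map_mul_pow_comm (hτ : IsPosTrace τ) (x y : A) (n : ℕ) :
    τ ((x * y) ^ n) = τ ((y * x) ^ n) := by
  cases n with
  | zero => simp
  | succ n =>
    have h : ∀ m : ℕ, (x * y) ^ m * x = x * (y * x) ^ m := by
      intro m
      induction m with
      | zero => simp
      | succ m ih => rw [pow_succ', mul_assoc, ih, pow_succ']; simp only [mul_assoc]
    rw [pow_succ, ← mul_assoc, h, hτ.comm, ← mul_assoc, ← pow_succ']

section

variable [StarModule ℂ A]

theorem map_star (hτ : IsPosTrace τ) (a : A) : τ (star a) = starRingEnd ℂ (τ a) := by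
  have h0 := (hτ.pos a).2
  have h1 := (hτ.pos (1 : A)).2
  have h2 := (hτ.pos (a + 1)).2
  have h3 := (hτ.pos (a + Complex.I • 1)).2
  simp only [star_add, star_one, star_smul, mul_add, add_mul, mul_one, one_mul, map_add,
    Complex.add_im, smul_mul_assoc, mul_smul_comm, map_smul, smul_eq_mul, Complex.mul_im,
    Complex.mul_re, Complex.star_def, Complex.conj_I, Complex.neg_re, Complex.neg_im, Complex.I_re,
    Complex.I_im] at h0 h1 h2 h3
  apply Complex.ext
  · simp only [Complex.conj_re]; linarith
  · simp only [Complex.conj_im]; linarith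

/-- The sesquilinear form `τ(x^* y)`. -/
abbrev innerCore (hτ : IsPosTrace τ) : PreInnerProductSpace.Core ℂ A where
  inner x y := τ (star x * y)
  conj_inner_symm x y := by simp [← hτ.map_star]
  re_inner_nonneg x := (hτ.pos x).1
  add_left x y z := by simp [add_mul]
  smul_left x y r := by simp

theorem norm_map_mul_le (hτ : IsPosTrace τ) (x y : A) :
    ‖τ (x * y)‖ ≤ traceNorm τ x * traceNorm τ y := by
  have h : ‖τ (star (star x) * y)‖ ≤ traceNorm τ (star x) * traceNorm τ y :=
    @InnerProductSpace.Core.norm_inner_le_norm ℂ A _ _ _ hτ.innerCore (star x) y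
  rwa [star_star, hτ.traceNorm_star] at h

theorem traceNorm_add_le (hτ : IsPosTrace τ) (x y : A) :
    traceNorm τ (x + y) ≤ traceNorm τ x + traceNorm τ y := by
  refine abs_le_of_sq_le_sq' ?_ (add_nonneg (traceNorm_nonneg _) (traceNorm_nonneg _)) |>.2
  have hx := hτ.sq_traceNorm x
  have hy := hτ.sq_traceNorm y
  have h1 := hτ.norm_map_mul_le (star x) y
  have h2 := hτ.norm_map_mul_le (star y) x
  rw [hτ.traceNorm_star] at h1 h2
  have h3 : ‖τ (star (x + y) * (x + y))‖ ≤
      ‖τ (star x * x)‖ + ‖τ (star x * y)‖ + (‖τ (star y * x)‖ + ‖τ (star y * y)‖) := by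
    have : τ (star (x + y) * (x + y)) =
        τ (star x * x) + τ (star x * y) + (τ (star y * x) + τ (star y * y)) := by
      simp only [star_add, add_mul, mul_add, map_add]; ring
    rw [this]
    exact (norm_add_le _ _).trans (add_le_add (norm_add_le _ _) (norm_add_le _ _))
  rw [hτ.sq_traceNorm]
  nlinarith

/-- Generalized Hölder inequality for words of length a power of two, by reflection positivity
(the chessboard estimate). -/
theorem norm_map_prod_le (hτ : IsPosTrace τ) {F : Set A} (hF : F.Finite)
    (hstar : ∀ x ∈ F, star x ∈ F) {k : ℕ} {C : ℝ}
    (hC : ∀ x ∈ F, ‖τ ((x * star x) ^ 2 ^ k)‖ ≤ C) (l : List A) (hl : l.length = 2 ^ (k + 1))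
    (hlF : ∀ x ∈ l, x ∈ F) : ‖τ l.prod‖ ≤ C := by
  have hfin : {l : List A | l.length = 2 ^ (k + 1) ∧ ∀ x ∈ l, x ∈ F}.Finite := by
    have := hF.to_subtype
    refine ((List.finite_length_eq F (2 ^ (k + 1))).image (List.map Subtype.val)).subset ?_
    rintro l ⟨h1, h2⟩
    lift l to List F using h2
    exact ⟨l, by simpa using h1, rfl⟩
  obtain ⟨m, ⟨hm, hmF⟩, hmax⟩ := Set.exists_max_image _ (fun l : List A => ‖τ l.prod‖) hfin
    ⟨l, hl, hlF⟩
  refine (hmax l ⟨hl, hlF⟩).trans ?_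
  set M := ‖τ m.prod‖ with hM
  have key : ∀ j ≤ k + 1, ∃ x ∈ F, ∃ p : List A, p.length = 2 ^ (k + 1) - 2 ^ j ∧
      (∀ y ∈ p, y ∈ F) ∧ M ≤ ‖τ (p.prod * reflectPow x j)‖ := by
    intro j
    induction j with
    | zero =>
      intro _
      cases m with
      | nil => exact absurd hm.symm (by simp)
      | cons x m =>
        refine ⟨x, hmF x (by simp), m, by simp at hm ⊢; omega, fun y hy => hmF y (by simp [hy]), ?_⟩
        rw [hM, List.prod_cons, hτ.comm]
        rfl
    | succ j ih =>
      intro hj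
      obtain ⟨x, hx, p, hp, hpF, hpM⟩ := ih (by omega)
      have hjk : 2 ^ j ≤ 2 ^ k := Nat.pow_le_pow_right (by norm_num) (by omega)
      have hk2 : 2 ^ (k + 1) = 2 ^ k + 2 ^ k := by rw [pow_succ, mul_two]
      have hj2 : 2 ^ (j + 1) = 2 ^ j + 2 ^ j := by rw [pow_succ, mul_two]
      set p₁ := p.take (2 ^ k)
      set p₂ := p.drop (2 ^ k)
      have h₁ : p₁.length = 2 ^ k := by simp [p₁, hp]; omega
      have h₂ : p₂.length = 2 ^ k - 2 ^ j := by simp [p₂, hp]; omega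
      have h₁F : ∀ y ∈ p₁, y ∈ F := fun y hy => hpF y (List.mem_of_mem_take hy)
      have h₂F : ∀ y ∈ p₂, y ∈ F := fun y hy => hpF y (List.mem_of_mem_drop hy)
      have hstarF : ∀ {q : List A}, (∀ y ∈ q, y ∈ F) → ∀ y ∈ (q.map star).reverse, y ∈ F := by
        intro q hq y hy
        simp only [List.mem_reverse, List.mem_map] at hy
        obtain ⟨z, hz, rfl⟩ := hy
        exact hstar z (hq z hz)
      refine ⟨x, hx, (p₂.map star).reverse ++ p₂, by simp [h₂]; omega, ?_, ?_⟩
      · intro y hy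
        rcases List.mem_append.1 hy with hy | hy
        · exact hstarF h₂F y hy
        · exact h₂F y hy
      · have hsplit : p.prod = p₁.prod * p₂.prod := (List.prod_take_mul_prod_drop p (2 ^ k)).symm
        rw [hsplit, mul_assoc] at hpM
        have hcs := hτ.norm_map_mul_le p₁.prod (p₂.prod * reflectPow x j)
        have e₁ : traceNorm τ p₁.prod ^ 2 ≤ M := by
          rw [hτ.sq_traceNorm, ← List.prod_map_star_reverse, ← List.prod_append]
          refine hmax _ ⟨by simp [h₁]; omega, ?_⟩
          intro y hy
          rcases List.mem_append.1 hy with hy | hy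
          · exact hstarF h₁F y hy
          · exact h₁F y hy
        have e₂ : traceNorm τ (p₂.prod * reflectPow x j) ^ 2 =
            ‖τ (((p₂.map star).reverse ++ p₂).prod * reflectPow x (j + 1))‖ := by
          rw [hτ.sq_traceNorm, List.prod_append, List.prod_map_star_reverse, reflectPow, star_mul]
          congr 1
          rw [mul_assoc, hτ.comm]
          simp only [mul_assoc]
        rw [← e₂]
        have hM0 : 0 ≤ M := norm_nonneg _
        rcases hM0.eq_or_lt with h0 | h0
        · rw [← h0]; positivity
        have := traceNorm_nonneg (τ := τ) p₁.prod
        have := traceNorm_nonneg (τ := τ) (p₂.prod * reflectPow x j)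
        have h5 : M ^ 2 ≤ M * traceNorm τ (p₂.prod * reflectPow x j) ^ 2 := by
          calc M ^ 2 ≤ (traceNorm τ p₁.prod * traceNorm τ (p₂.prod * reflectPow x j)) ^ 2 := by
                gcongr; exact hpM.trans hcs
            _ = traceNorm τ p₁.prod ^ 2 * traceNorm τ (p₂.prod * reflectPow x j) ^ 2 := by ring
            _ ≤ _ := by gcongr
        nlinarith
  obtain ⟨x, hx, p, hp, -, hpM⟩ := key (k + 1) le_rfl
  have : p = [] := by simpa using hp
  rw [this, List.prod_nil, one_mul, reflectPow_succ_eq] at hpM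
  exact hpM.trans (hC x hx)

/-- If `τ(y^{N-1} x) = τ(y^N)`, as for `y` a conditional expectation of `x`, then
`τ(y^N) ≤ τ(x^N)`, for `N` a power of two. -/
theorem norm_map_pow_le (hτ : IsPosTrace τ) {x y : A} (hx : star x = x) (hy : star y = y) (k : ℕ)
    (h : τ (y ^ (2 ^ (k + 1) - 1) * x) = τ (y ^ 2 ^ (k + 1))) :
    ‖τ (y ^ 2 ^ (k + 1))‖ ≤ ‖τ (x ^ 2 ^ (k + 1))‖ := by
  by_contra! hlt
  set N := 2 ^ (k + 1) with hN
  have hN0 : 0 < N := by positivity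
  obtain ⟨c, hc1, hc⟩ : ∃ c : ℝ, 1 < c ∧ c ^ N * ‖τ (x ^ N)‖ < ‖τ (y ^ N)‖ := by
    have hcont : Tendsto (fun c : ℝ => c ^ N * ‖τ (x ^ N)‖) (𝓝[>] 1) (𝓝 (1 ^ N * ‖τ (x ^ N)‖)) :=
      (Continuous.tendsto (by fun_prop) 1).mono_left nhdsWithin_le_nhds
    rw [one_pow, one_mul] at hcont
    obtain ⟨c, h1, h2⟩ := ((eventually_mem_nhdsWithin (a := (1 : ℝ)) (s := Set.Ioi 1)).and
      (hcont.eventually (gt_mem_nhds hlt))).exists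
    exact ⟨c, h1, h2⟩
  have hcx : star ((c : ℂ) • x) = (c : ℂ) • x := by simp [star_smul, hx]
  have hpow : ∀ z : A, (z * z) ^ 2 ^ k = z ^ N := fun z => by
    rw [← pow_two, ← pow_mul, hN, pow_succ, mul_comm]
  have := hτ.norm_map_prod_le (F := {y, (c : ℂ) • x}) (by simp) (by
      rintro z (rfl | rfl)
      · rw [hy]; simp
      · rw [hcx]; simp) (k := k)
    (C := ‖τ (y ^ N)‖) (by
      intro z hz
      rcases hz with rfl | rfl
      · rw [hy, hpow]
      · rw [hcx, hpow, smul_pow, map_smul, smul_eq_mul, norm_mul, norm_pow, Complex.norm_real,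
          Real.norm_of_nonneg (by linarith)]
        exact hc.le)
    (List.replicate (N - 1) y ++ [(c : ℂ) • x]) (by simp; omega) (by
      intro z hz
      simp only [List.mem_append, List.mem_replicate, List.mem_singleton] at hz
      rcases hz with ⟨-, rfl⟩ | rfl <;> simp)
  rw [List.prod_append, List.prod_replicate, List.prod_singleton, mul_smul_comm, map_smul, h,
    smul_eq_mul, norm_mul, Complex.norm_real, Real.norm_of_nonneg (by linarith)] at this
  have h0 : 0 < ‖τ (y ^ N)‖ := lt_of_le_of_lt (norm_nonneg _) hlt
  nlinarith

end

end IsPosTrace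

end PositiveTrace

section BoundedFamilies

variable {A : Type*} [Ring A] [Algebra ℂ A] [StarRing A] [StarModule ℂ A] {α : Type*}

/-- The star algebra of families in `A` generated by those all of whose moments stay bounded along
the filter `l`. -/
def boundedFamilies (τ : A →ₗ[ℂ] ℂ) (l : Filter α) : StarSubalgebra ℂ (α → A) :=
  StarAlgebra.adjoin ℂ
    {x | ∀ k : ℕ, (fun t => τ ((x t * star (x t)) ^ 2 ^ k)) =O[l] (fun _ => (1 : ℝ))}

variable {τ : A →ₗ[ℂ] ℂ} {l : Filter α}

theorem const_mem_boundedFamilies (a : A) : (fun _ => a) ∈ boundedFamilies τ l :=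
  StarAlgebra.subset_adjoin _ _ fun _ => Asymptotics.isBigO_const_const _ one_ne_zero _

theorem IsPosTrace.isBigO_map_list_prod (hτ : IsPosTrace τ) (L : List (α → A))
    (hL : ∀ x ∈ L, ∀ k : ℕ,
      (fun t => τ ((x t * star (x t)) ^ 2 ^ k)) =O[l] (fun _ => (1 : ℝ))) :
    (fun t => τ (L.prod t)) =O[l] (fun _ => (1 : ℝ)) := by
  obtain ⟨k, hk⟩ : ∃ k : ℕ, L.length ≤ 2 ^ (k + 1) :=
    ⟨L.length, (Nat.lt_two_pow_self.le).trans (Nat.pow_le_pow_right (by norm_num) (by omega))⟩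
  have hbd : ∀ L : List (α → A), (∀ x ∈ L, ∀ k : ℕ,
      (fun t => τ ((x t * star (x t)) ^ 2 ^ k)) =O[l] (fun _ => (1 : ℝ))) →
      ∃ C : ℝ, ∀ᶠ t in l, ∀ x ∈ L, ‖τ ((x t * star (x t)) ^ 2 ^ k)‖ ≤ C := by
    intro L hL
    induction L with
    | nil => exact ⟨0, by simp⟩
    | cons x L ih =>
      obtain ⟨C, hC⟩ := ih fun y hy => hL y (by simp [hy])
      obtain ⟨C', hC'⟩ := (hL x (by simp) k).bound
      refine ⟨max C' C, ?_⟩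
      filter_upwards [hC, hC'] with t h h' y hy
      rcases List.mem_cons.1 hy with rfl | hy
      · exact (by simpa using h' : _ ≤ C').trans (le_max_left _ _)
      · exact (h y hy).trans (le_max_right _ _)
  obtain ⟨C, hC⟩ := hbd ((1 : α → A) :: L) (by
    intro x hx k
    rcases List.mem_cons.1 hx with rfl | hx
    · simpa using Asymptotics.isBigO_const_const (τ 1) (one_ne_zero (α := ℝ)) l
    · exact hL x hx k)
  refine Asymptotics.IsBigO.of_bound C ?_
  filter_upwards [hC] with t ht
  rw [norm_one, mul_one]
  set F : Set A := {y | ∃ x : α → A, x ∈ 1 :: L ∧ (y = x t ∨ y = star (x t))}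
  have hFfin : F.Finite := by
    have hunion : F = ⋃ x : α → A, ⋃ _ : x ∈ {x | x ∈ 1 :: L}, ({x t, star (x t)} : Set A) := by
      ext y; simp [F]
    rw [hunion]
    exact (List.finite_toSet _).biUnion fun x _ => by simp
  have hprod : L.prod t = (L.map (fun x : α → A => x t) ++
      List.replicate (2 ^ (k + 1) - L.length) 1).prod := by
    rw [List.prod_append, List.prod_replicate, one_pow, mul_one]
    exact map_list_prod (Pi.evalMonoidHom (fun _ : α => A) t) L
  rw [hprod]
  refine hτ.norm_map_prod_le hFfin ?_ (k := k) ?_ _ (by simp; omega) ?_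
  · rintro y ⟨x, hx, rfl | rfl⟩
    · exact ⟨x, hx, Or.inr rfl⟩
    · exact ⟨x, hx, Or.inl (star_star _)⟩
  · rintro y ⟨x, hx, rfl | rfl⟩
    · exact ht x hx
    · rw [star_star, hτ.map_mul_pow_comm]; exact ht x hx
  · intro y hy
    rcases List.mem_append.1 hy with hy | hy
    · obtain ⟨x, hx, rfl⟩ := List.mem_map.1 hy
      exact ⟨x, by simp [hx], Or.inl rfl⟩
    · exact ⟨1, by simp, Or.inl (List.eq_of_mem_replicate hy)⟩

theorem IsPosTrace.isBigO_map_of_mem (hτ : IsPosTrace τ) {x : α → A}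
    (hx : x ∈ boundedFamilies τ l) : (fun t => τ (x t)) =O[l] (fun _ => (1 : ℝ)) := by
  have hx' : x ∈ Submodule.span ℂ (Submonoid.closure
      {x : α → A | ∀ k : ℕ,
        (fun t => τ ((x t * star (x t)) ^ 2 ^ k)) =O[l] (fun _ => (1 : ℝ))} : Set (α → A)) := by
    rw [← Algebra.adjoin_eq_span]
    refine Algebra.adjoin_mono ?_ (show x ∈ Algebra.adjoin ℂ _ from hx)
    refine Set.union_subset le_rfl fun y hy k => ?_
    refine (hy k).congr_left fun t => ?_
    rw [Pi.star_apply, star_star, hτ.map_mul_pow_comm]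
  clear hx
  induction hx' using Submodule.span_induction with
  | mem x h =>
    obtain ⟨L, hL, rfl⟩ := Submonoid.exists_list_of_mem_closure h
    exact hτ.isBigO_map_list_prod L hL
  | zero => simpa using Asymptotics.isBigO_zero (E' := ℂ) (fun _ : α => (1 : ℝ)) l
  | add x y _ _ hx hy => simpa using hx.add hy
  | smul c x _ hx => simpa using hx.const_mul_left c

theorem IsPosTrace.isBigO_traceNorm_of_mem (hτ : IsPosTrace τ) {x : α → A}
    (hx : x ∈ boundedFamilies τ l) : (fun t => traceNorm τ (x t)) =O[l] (fun _ => (1 : ℝ)) := by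
  refine Asymptotics.IsBigO.of_pow (n := 2) two_ne_zero ?_
  have h := (hτ.isBigO_map_of_mem (mul_mem (star_mem hx) hx)).norm_left
  refine h.congr (fun t => ?_) fun t => by simp
  rw [Pi.pow_apply, hτ.sq_traceNorm]; rfl

end BoundedFamilies

section RpowAsymptotics

variable {α : Type*} {l : Filter α} {h : α → ℝ}

theorem isBigO_rpow_of_le (h0 : ∀ᶠ t in l, 0 < h t ∧ h t ≤ 1) {a b : ℝ} (hab : b ≤ a) :
    (fun t => h t ^ a) =O[l] (fun t => h t ^ b) := by
  refine Asymptotics.IsBigO.of_bound 1 ?_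
  filter_upwards [h0] with t ht
  rw [one_mul, Real.norm_of_nonneg (Real.rpow_nonneg ht.1.le _),
    Real.norm_of_nonneg (Real.rpow_nonneg ht.1.le _)]
  exact Real.rpow_le_rpow_of_exponent_ge ht.1 ht.2 hab

theorem Asymptotics.IsBigO.mul_rpow (h0 : ∀ᶠ t in l, 0 < h t ∧ h t ≤ 1) {f g : α → ℝ} {a b c : ℝ}
    (hf : f =O[l] (fun t => h t ^ a)) (hg : g =O[l] (fun t => h t ^ b)) (hc : c ≤ a + b) :
    (fun t => f t * g t) =O[l] (fun t => h t ^ c) := by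
  refine ((hf.mul hg).congr' .rfl ?_).trans (isBigO_rpow_of_le h0 hc)
  filter_upwards [h0] with t ht
  rw [Real.rpow_add ht.1]

theorem isBigO_rpow_of_sq (h0 : ∀ᶠ t in l, 0 < h t ∧ h t ≤ 1) {f : α → ℝ} {a b : ℝ}
    (hf : (fun t => f t ^ 2) =O[l] (fun t => h t ^ a)) (hb : b ≤ a / 2) :
    f =O[l] (fun t => h t ^ b) := by
  refine Asymptotics.IsBigO.trans ?_ (isBigO_rpow_of_le h0 hb)
  refine Asymptotics.IsBigO.of_pow (n := 2) two_ne_zero (hf.congr' .rfl ?_)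
  filter_upwards [h0] with t ht
  rw [Pi.pow_apply, ← Real.rpow_natCast, ← Real.rpow_mul ht.1.le]
  congr 1; push_cast; ring

end RpowAsymptotics

section TripleEstimate

variable {A : Type*} [Ring A] [Algebra ℂ A] [StarRing A] [StarModule ℂ A] {α : Type*}
  {τ : A →ₗ[ℂ] ℂ} {l : Filter α} {h : α → ℝ}

theorem IsPosTrace.sq_traceNorm_mul_mul_le (hτ : IsPosTrace τ) (u x v : A) :
    traceNorm τ (u * x * v) ^ 2 ≤
      traceNorm τ x * traceNorm τ ((star u * u) * x * (v * star v)) := by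
  rw [hτ.sq_traceNorm, ← hτ.traceNorm_star x]
  refine le_trans (le_of_eq ?_) (hτ.norm_map_mul_le (star x) _)
  congr 1
  rw [star_mul, mul_assoc, hτ.comm]
  simp only [star_mul, mul_assoc]

/-- Multiplication by bounded families costs an arbitrarily small power. -/
theorem IsPosTrace.isBigO_traceNorm_mul_mul (hτ : IsPosTrace τ)
    (h0 : ∀ᶠ t in l, 0 < h t ∧ h t ≤ 1) {x : α → A} (hx : x ∈ boundedFamilies τ l) {a b : ℝ}
    (hxa : (fun t => traceNorm τ (x t)) =O[l] (fun t => h t ^ a)) (hab : b < a) (ha : 0 < a)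
    {u v : α → A} (hu : u ∈ boundedFamilies τ l) (hv : v ∈ boundedFamilies τ l) :
    (fun t => traceNorm τ (u t * x t * v t)) =O[l] (fun t => h t ^ b) := by
  have key : ∀ k : ℕ, ∀ u ∈ boundedFamilies τ l, ∀ v ∈ boundedFamilies τ l,
      (fun t => traceNorm τ (u t * x t * v t)) =O[l] (fun t => h t ^ (a * (1 - (1 / 2) ^ k))) := by
    intro k
    induction k with
    | zero =>
      intro u hu v hv
      simpa using hτ.isBigO_traceNorm_of_mem (mul_mem (mul_mem hu hx) hv)
    | succ k ih =>
      intro u hu v hv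
      have h1 := ih _ (mul_mem (star_mem hu) hu) _ (mul_mem hv (star_mem hv))
      refine isBigO_rpow_of_sq (a := a + a * (1 - (1 / 2) ^ k)) h0 ?_ (le_of_eq (by ring))
      refine Asymptotics.IsBigO.trans ?_ (hxa.mul_rpow h0 h1 le_rfl)
      refine Asymptotics.IsBigO.of_bound 1 (Eventually.of_forall fun t => ?_)
      rw [one_mul, Real.norm_of_nonneg (sq_nonneg _)]
      exact (hτ.sq_traceNorm_mul_mul_le (u t) (x t) (v t)).trans (le_abs_self _)
  obtain ⟨k, hk⟩ : ∃ k : ℕ, (1 / 2 : ℝ) ^ k < 1 - b / a :=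
    exists_pow_lt_of_lt_one (by rw [sub_pos, div_lt_one ha]; exact hab) (by norm_num)
  refine (key k u hu v hv).trans (isBigO_rpow_of_le h0 ?_)
  have : b = a * (b / a) := by field_simp
  rw [this]
  gcongr
  linarith

/-- The fourth moment of a family `D = U + V`, with `U` small in `L⁴` and `V` small in `L²`. -/
theorem IsPosTrace.isBigO_traceNorm_sq (hτ : IsPosTrace τ)
    (h0 : ∀ᶠ t in l, 0 < h t ∧ h t ≤ 1) {D U V : α → A} (hD : D ∈ boundedFamilies τ l)
    (hsa : ∀ᶠ t in l, star (D t) = D t) (hUV : ∀ᶠ t in l, D t = U t + V t)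
    (hU : (fun t => traceNorm τ (star (U t) * U t)) =O[l] (fun t => h t ^ (3 / 4 : ℝ)))
    (hV : (fun t => traceNorm τ (V t)) =O[l] (fun t => h t ^ (1 : ℝ))) :
    (fun t => traceNorm τ (D t)) =O[l] (fun t => h t ^ (3 / 8 : ℝ)) ∧
    (fun t => traceNorm τ (D t * D t)) =O[l] (fun t => h t ^ (21 / 32 : ℝ)) := by
  have hU' : (fun t => traceNorm τ (U t * star (U t))) =O[l] (fun t => h t ^ (3 / 4 : ℝ)) := by
    refine hU.congr_left fun t => ?_
    rw [traceNorm, traceNorm]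
    simp only [star_mul, star_star]
    rw [← pow_two, ← pow_two, hτ.map_mul_pow_comm]
  have hU2 : (fun t => traceNorm τ (U t)) =O[l] (fun t => h t ^ (3 / 8 : ℝ)) := by
    refine isBigO_rpow_of_sq (a := 3 / 4) h0 ?_ (by norm_num)
    refine Asymptotics.IsBigO.trans ?_ ((hU.const_mul_left (traceNorm τ 1)))
    refine Asymptotics.IsBigO.of_bound 1 (Eventually.of_forall fun t => ?_)
    rw [one_mul, Real.norm_of_nonneg (sq_nonneg _), hτ.sq_traceNorm]
    refine le_trans ?_ (le_abs_self _)
    simpa using hτ.norm_map_mul_le 1 (star (U t) * U t)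
  have hD2 : (fun t => traceNorm τ (D t)) =O[l] (fun t => h t ^ (3 / 8 : ℝ)) := by
    refine Asymptotics.IsBigO.trans ?_
      (hU2.add (hV.trans (isBigO_rpow_of_le h0 (b := 3 / 8) (by norm_num))))
    refine Asymptotics.IsBigO.of_bound 1 ?_
    filter_upwards [hUV] with t ht
    rw [one_mul, Real.norm_of_nonneg (IsPosTrace.traceNorm_nonneg _), ht]
    exact (hτ.traceNorm_add_le _ _).trans (le_abs_self _)
  refine ⟨hD2, ?_⟩
  have hD3 := hτ.isBigO_traceNorm_mul_mul h0 hD hD2 (b := 5 / 16) (by norm_num) (by norm_num) hD hD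
  have hDV := hD3.mul_rpow h0 hV (c := 21 / 16) (by norm_num)
  have hDU : (fun t => traceNorm τ (D t * D t * U t)) =O[l] (fun t => h t ^ (3 / 8 : ℝ)) := by
    refine isBigO_rpow_of_sq (a := 3 / 4) h0 ?_ (by norm_num)
    have h4 := hτ.isBigO_traceNorm_of_mem (mul_mem (mul_mem hD hD) (mul_mem hD hD))
    refine Asymptotics.IsBigO.trans ?_ ((h4.mul hU').congr_right fun t => one_mul _)
    refine Asymptotics.IsBigO.of_bound 1 ?_
    filter_upwards [hsa] with t ht
    rw [one_mul, Real.norm_of_nonneg (sq_nonneg _), hτ.sq_traceNorm]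
    refine le_trans (le_of_eq ?_) ((hτ.norm_map_mul_le (D t * D t * (D t * D t))
      (U t * star (U t))).trans (le_abs_self _))
    rw [star_mul, star_mul, ht, mul_assoc, hτ.comm]
    simp only [mul_assoc]
  have hDUV := hDU.mul_rpow h0 hV (c := 21 / 16) (by norm_num)
  have hbound : ∀ᶠ t in l, traceNorm τ (D t * D t) ^ 2 ≤
      traceNorm τ (U t * star (U t)) ^ 2 +
      2 * (traceNorm τ (D t * D t * U t) * traceNorm τ (V t) +
        traceNorm τ (D t * D t * D t) * traceNorm τ (V t)) := by
    filter_upwards [hsa, hUV] with t ht ht'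
    set d := D t
    set u := U t
    set v := V t
    have e : τ (star (d * d) * (d * d)) =
        τ ((d * d) * (u * star u)) + τ ((d * d * u) * star v) + τ ((d * d * d) * v) := by
      have e1 : star (d * d) * (d * d) = d * d * d * u + d * d * d * v := by
        rw [star_mul, ht, ← mul_add, ← ht', ← mul_assoc]
      have e2 : τ (d * d * d * u) = τ ((d * d) * (u * star u)) + τ ((d * d * u) * star v) := by
        have : τ (d * d * d * u) = τ (d * d * u * star d) := by
          rw [ht, mul_assoc d d d, mul_assoc, hτ.comm]
        rw [this, ht', star_add, ← ht', mul_add, map_add]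
        simp only [mul_assoc]
      rw [e1, map_add, e2]
    have h1 := hτ.norm_map_mul_le (d * d) (u * star u)
    have h2 := hτ.norm_map_mul_le (d * d * u) (star v)
    have h3 := hτ.norm_map_mul_le (d * d * d) v
    rw [hτ.traceNorm_star] at h2
    have hs := hτ.sq_traceNorm (d * d)
    rw [e] at hs
    have := norm_add_le (τ ((d * d) * (u * star u)) + τ ((d * d * u) * star v))
      (τ ((d * d * d) * v))
    have := norm_add_le (τ ((d * d) * (u * star u))) (τ ((d * d * u) * star v))
    nlinarith [sq_nonneg (traceNorm τ (d * d) - traceNorm τ (u * star u))]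
  refine isBigO_rpow_of_sq (a := 21 / 16) h0 ?_ (by norm_num)
  have hUU : (fun t => traceNorm τ (U t * star (U t)) ^ 2) =O[l] (fun t => h t ^ (21 / 16 : ℝ)) :=
    (hU'.mul_rpow h0 hU' (c := 21 / 16) (by norm_num)).congr_left fun t => (pow_two _).symm
  refine Asymptotics.IsBigO.trans ?_ (hUU.add ((hDUV.add hDV).const_mul_left 2))
  refine Asymptotics.IsBigO.of_bound 1 ?_
  filter_upwards [hbound] with t ht
  rw [one_mul, Real.norm_of_nonneg (sq_nonneg _)]
  exact ht.trans (le_abs_self _)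

/-- Words with three small increments are negligible. -/
theorem IsPosTrace.isLittleO_triple (hτ : IsPosTrace τ)
    (h0 : ∀ᶠ t in l, 0 < h t ∧ h t ≤ 1) (hl : Tendsto h l (𝓝 0)) {ι : Type*} {D : ι → α → A}
    (hD : ∀ i, D i ∈ boundedFamilies τ l) (hsa : ∀ i, ∀ᶠ t in l, star (D i t) = D i t)
    (h1 : ∀ i, (fun t => traceNorm τ (D i t)) =O[l] (fun t => h t ^ (3 / 8 : ℝ)))
    (h2 : ∀ i, (fun t => traceNorm τ (D i t * D i t)) =O[l] (fun t => h t ^ (21 / 32 : ℝ)))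
    (i j k : ι) {x y z : α → A} (hx : x ∈ boundedFamilies τ l) (hy : y ∈ boundedFamilies τ l)
    (hz : z ∈ boundedFamilies τ l) :
    (fun t => τ (D i t * x t * D j t * (y t * D k t * z t))) =o[l] h := by
  have hyz := hτ.isBigO_traceNorm_mul_mul h0 (hD k) (h1 k) (b := 47 / 128) (by norm_num)
    (by norm_num) hy hz
  have hxx := hτ.isBigO_traceNorm_mul_mul h0 (mul_mem (hD j) (hD j)) (h2 j) (b := 20 / 32)
    (by norm_num) (by norm_num) hx (star_mem hx)
  have hDxD : (fun t => traceNorm τ (D i t * x t * D j t)) =O[l]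
      (fun t => h t ^ (41 / 64 : ℝ)) := by
    refine isBigO_rpow_of_sq (a := 41 / 32) h0 ?_ (by norm_num)
    refine Asymptotics.IsBigO.trans ?_ ((h2 i).mul_rpow h0 hxx (c := 41 / 32) (by norm_num))
    refine Asymptotics.IsBigO.of_bound 1 ?_
    filter_upwards [hsa i, hsa j] with t hi hj
    rw [one_mul, Real.norm_of_nonneg (sq_nonneg _), hτ.sq_traceNorm]
    refine le_trans (le_of_eq ?_) ((hτ.norm_map_mul_le _ _).trans (le_abs_self _))
    simp only [Pi.mul_apply, Pi.star_apply]
    have e1 : τ (star (D i t * x t * D j t) * (D i t * x t * D j t)) =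
        τ ((D j t * star (x t)) * (D i t * D i t * x t * D j t)) := by
      rw [star_mul, star_mul, hi, hj]
      simp only [mul_assoc]
    rw [e1, hτ.comm]
    simp only [mul_assoc]
  have hall := hDxD.mul_rpow h0 hyz (c := 129 / 128) (by norm_num)
  have hsmall : (fun t => h t ^ (129 / 128 : ℝ)) =o[l] h := by
    have h3 : (fun t => h t ^ (1 / 128 : ℝ)) =o[l] (fun _ => (1 : ℝ)) := by
      rw [Asymptotics.isLittleO_one_iff]
      simpa using hl.rpow_const (p := 1 / 128) (Or.inr (by norm_num))
    refine (h3.mul_isBigO (Asymptotics.isBigO_refl h l)).congr' ?_ (by simp)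
    filter_upwards [h0] with t ht
    rw [show (129 / 128 : ℝ) = 1 / 128 + 1 by norm_num, Real.rpow_add ht.1, Real.rpow_one]
  refine Asymptotics.IsBigO.trans_isLittleO ?_ hsmall
  refine Asymptotics.IsBigO.trans (Asymptotics.IsBigO.of_bound 1
    (Eventually.of_forall fun t => ?_)) hall
  rw [one_mul]
  exact (hτ.norm_map_mul_le _ _).trans (le_abs_self _)

end TripleEstimate

section Words

variable {n : ℕ} {A : Type*}

/-- A letter `(Z_s^j - q) c` of a word in the increments of a process. -/
structure Letter (n : ℕ) (A : Type*) where
  /-- the time `s` -/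
  time : ℝ
  /-- the component `j` -/
  idx : Fin n
  /-- the shift `q` -/
  shift : A
  /-- the coefficient `c` -/
  coef : A

/-- All letters of the word have their shifts and coefficients in `S`. -/
def IsAdaptedWord (S : Set A) (w : List (Letter n A)) : Prop :=
  ∀ p ∈ w, 0 ≤ p.time ∧ p.shift ∈ S ∧ p.coef ∈ S

theorem IsAdaptedWord.mono {S T : Set A} (h : S ⊆ T) {w : List (Letter n A)}
    (hw : IsAdaptedWord S w) : IsAdaptedWord T w :=
  fun p hp => ⟨(hw p hp).1, h (hw p hp).2.1, h (hw p hp).2.2⟩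

theorem isAdaptedWord_cons {S : Set A} {p : Letter n A} {w : List (Letter n A)} :
    IsAdaptedWord S (p :: w) ↔
      (0 ≤ p.time ∧ p.shift ∈ S ∧ p.coef ∈ S) ∧ IsAdaptedWord S w := by
  simp [IsAdaptedWord]

theorem isAdaptedWord_append {S : Set A} {u w : List (Letter n A)} :
    IsAdaptedWord S (u ++ w) ↔ IsAdaptedWord S u ∧ IsAdaptedWord S w := by
  simp only [IsAdaptedWord, List.mem_append]
  exact ⟨fun h => ⟨fun p hp => h p (Or.inl hp), fun p hp => h p (Or.inr hp)⟩,
    fun h p hp => hp.elim (h.1 p) (h.2 p)⟩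

variable [Ring A]

/-- The value of a letter. -/
def Letter.eval (Z : ℝ → Fin n → A) (p : Letter n A) : A :=
  (Z p.time p.idx - p.shift) * p.coef

/-- The value of a word. -/
def evalWord (Z : ℝ → Fin n → A) (w : List (Letter n A)) : A :=
  (w.map (Letter.eval Z)).prod

@[simp] theorem evalWord_nil (Z : ℝ → Fin n → A) : evalWord Z [] = 1 := rfl

@[simp] theorem evalWord_cons (Z : ℝ → Fin n → A) (p : Letter n A) (w : List (Letter n A)) :
    evalWord Z (p :: w) = p.eval Z * evalWord Z w := by
  simp [evalWord]

@[simp] theorem evalWord_append (Z : ℝ → Fin n → A) (u w : List (Letter n A)) :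
    evalWord Z (u ++ w) = evalWord Z u * evalWord Z w := by
  simp [evalWord]

/-- The right-hand side of the free Wick recursion for the word `x · w`: a sum over the letters
`p` of `w`, where `x` is multiplied by the letters which precede `p`, and `F` is applied to what
follows `p`. -/
def wickSum [Algebra ℂ A] (Z : ℝ → Fin n → A) (ζ : Fin n → A →ₗ[ℂ] A) (F : A →ₗ[ℂ] A)
    (φ : Letter n A → ℝ) : A → List (Letter n A) → A
  | _, [] => 0
  | x, p :: w => (φ p : ℂ) • (ζ p.idx x * F (p.coef * evalWord Z w)) +
      wickSum Z ζ F φ (x * p.eval Z) w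

/-- Replaces `Z_s - q` by `(Z_s - Z_t) + (Z_r - q)` in the letters with `r < s`. -/
def skipIncrement (Z : ℝ → Fin n → A) (r t : ℝ) (p : Letter n A) : Letter n A :=
  if r < p.time then { p with shift := p.shift + (Z t p.idx - Z r p.idx) } else p

@[simp] theorem skipIncrement_time (Z : ℝ → Fin n → A) (r t : ℝ) (p : Letter n A) :
    (skipIncrement Z r t p).time = p.time := by
  rw [skipIncrement]; split_ifs <;> rfl

@[simp] theorem skipIncrement_idx (Z : ℝ → Fin n → A) (r t : ℝ) (p : Letter n A) :
    (skipIncrement Z r t p).idx = p.idx := by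
  rw [skipIncrement]; split_ifs <;> rfl

@[simp] theorem skipIncrement_coef (Z : ℝ → Fin n → A) (r t : ℝ) (p : Letter n A) :
    (skipIncrement Z r t p).coef = p.coef := by
  rw [skipIncrement]; split_ifs <;> rfl

theorem eval_skipIncrement_of_lt {Z : ℝ → Fin n → A} {r t : ℝ} {p : Letter n A} (h : r < p.time) :
    (skipIncrement Z r t p).eval Z =
      (Z p.time p.idx - Z t p.idx) * p.coef + (Z r p.idx - p.shift) * p.coef := by
  rw [skipIncrement, if_pos h, Letter.eval]
  noncomm_ring

theorem skipIncrement_of_le {Z : ℝ → Fin n → A} {r t : ℝ} {p : Letter n A} (h : p.time ≤ r) :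
    skipIncrement Z r t p = p := if_neg h.not_gt

@[simp] theorem skipIncrement_self (Z : ℝ → Fin n → A) (r : ℝ) :
    skipIncrement Z r r = id := by
  funext p; rw [skipIncrement]; simp

theorem eval_eq_eval_skipIncrement {Z : ℝ → Fin n → A} (r t : ℝ) (p : Letter n A) :
    p.eval Z = (skipIncrement Z r t p).eval Z +
      (if r < p.time then Z t p.idx - Z r p.idx else 0) * p.coef := by
  split_ifs with h
  · rw [eval_skipIncrement_of_lt h, Letter.eval]
    noncomm_ring
  · rw [skipIncrement_of_le (not_lt.1 h), zero_mul, add_zero]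

theorem wickSum_eq_zero [Algebra ℂ A] {Z : ℝ → Fin n → A} {ζ : Fin n → A →ₗ[ℂ] A} {F : A →ₗ[ℂ] A}
    {φ : Letter n A → ℝ} {x : A} {v : List (Letter n A)}
    (h : ∀ m ∈ Finset.range v.length, ∀ q, ζ q (x * evalWord Z (v.take m)) = 0) :
    wickSum Z ζ F φ x v = 0 := by
  induction v generalizing x with
  | nil => rfl
  | cons p v ih =>
    rw [wickSum, ih fun m hm q => ?_]
    · simpa using Or.inr (by rw [show ζ p.idx x = 0 by simpa using h 0 (by simp) p.idx, zero_mul])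
    · simpa [mul_assoc] using h (m + 1) (by simpa using hm) q

theorem wickSum_zero [Algebra ℂ A] {Z : ℝ → Fin n → A} {ζ : Fin n → A →ₗ[ℂ] A} {F : A →ₗ[ℂ] A}
    {φ : Letter n A → ℝ} {x : A} {v : List (Letter n A)} (h : ∀ p ∈ v, φ p = 0) :
    wickSum Z ζ F φ x v = 0 := by
  induction v generalizing x with
  | nil => rfl
  | cons p v ih =>
    rw [wickSum, ih fun q hq => h q (List.mem_cons_of_mem p hq), h p List.mem_cons_self]
    simp

theorem hasDerivWithinAt_weight {r s t : ℝ} (ht : t ≤ r) :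
    HasDerivWithinAt (fun x => max 0 (min x s - t)) (if r < s then 1 else 0) (Set.Ici r) r := by
  split_ifs with h
  · refine ((hasDerivAt_id r).sub_const t).hasDerivWithinAt.congr_of_eventuallyEq ?_ ?_
    · filter_upwards [Ico_mem_nhdsGE h] with x hx
      rw [min_eq_left hx.2.le, max_eq_right (by linarith [hx.1])]
      rfl
    · rw [min_eq_left h.le, max_eq_right (by linarith)]
      rfl
  · refine (hasDerivWithinAt_const r _ (max 0 (s - t))).congr (fun x hx => ?_) ?_
    · rw [min_eq_right (le_trans (not_lt.1 h) hx)]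
    · rw [min_eq_right (not_lt.1 h)]

theorem hasDerivWithinAt_wickSum [Algebra ℂ A] {Z : ℝ → Fin n → A} (τ : A →ₗ[ℂ] ℂ)
    (ζ : Fin n → A →ₗ[ℂ] A) (b x : A) {r t : ℝ} (ht : t ≤ r)
    (w : List (Letter n A)) :
    HasDerivWithinAt (fun s => τ (b * wickSum Z ζ .id (fun p => max 0 (min s p.time - t)) x w))
      (τ (b * wickSum Z ζ .id (fun p => if r < p.time then 1 else 0) x w)) (Set.Ici r) r := by
  induction w generalizing x with
  | nil => simpa [wickSum] using hasDerivWithinAt_const r (Set.Ici r) (0 : ℂ)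
  | cons p w ih =>
    simp only [wickSum, mul_add, map_add, mul_smul_comm, map_smul, smul_eq_mul]
    exact ((hasDerivWithinAt_weight ht).ofReal_comp.mul_const _).add (ih _)

theorem continuous_wickSum [Algebra ℂ A] {Z : ℝ → Fin n → A} (τ : A →ₗ[ℂ] ℂ)
    (ζ : Fin n → A →ₗ[ℂ] A) (b x : A) (t : ℝ) (w : List (Letter n A)) :
    Continuous (fun s => τ (b * wickSum Z ζ .id (fun p => max 0 (min s p.time - t)) x w)) := by
  induction w generalizing x with
  | nil => simpa [wickSum] using continuous_const
  | cons p w ih =>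
    simp only [wickSum, mul_add, map_add, mul_smul_comm, map_smul, smul_eq_mul]
    exact ((Complex.continuous_ofReal.comp (by fun_prop)).mul continuous_const).add (ih _)

/-- A letter of a word in the increments after time `t`. -/
def incrementLetter (Z : ℝ → Fin n → A) (t : ℝ) (p : ({s : ℝ // t ≤ s} × Fin n) × A) :
    Letter n A :=
  ⟨p.1.1, p.1.2, Z t p.1.2, p.2⟩

theorem wprod_eq_mul_evalWord {Z : ℝ → Fin n → A} (t : ℝ) (b : A)
    (w : List (({s : ℝ // t ≤ s} × Fin n) × A)) :
    wprod (fun p : {s : ℝ // t ≤ s} × Fin n => Z (p.1 : ℝ) p.2 - Z t p.2) b w =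
      b * evalWord Z (w.map (incrementLetter Z t)) := by
  rw [wprod, evalWord, List.map_map]
  rfl

theorem wickSum_map_incrementLetter [Algebra ℂ A] {Z : ℝ → Fin n → A}
    (ζ : Fin n → A →ₗ[ℂ] A) (F : A →ₗ[ℂ] A) {s t : ℝ}
    (hts : t ≤ s) (x : A) (w : List (({s : ℝ // t ≤ s} × Fin n) × A)) :
    wickSum Z ζ F (fun p => max 0 (min s p.time - t)) x (w.map (incrementLetter Z t)) =
      ∑ k : Fin w.length, ((min s ((w.get k).1.1 : ℝ) - t : ℝ) : ℂ) •
        (ζ (w.get k).1.2 (x * evalWord Z ((w.take (k : ℕ)).map (incrementLetter Z t))) *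
          F ((w.get k).2 * evalWord Z ((w.drop ((k : ℕ) + 1)).map (incrementLetter Z t)))) := by
  induction w generalizing x with
  | nil => simp [wickSum]
  | cons p w ih =>
    have h : 0 ≤ min s (p.1.1 : ℝ) - t := sub_nonneg.2 (le_min hts p.1.1.2)
    rw [List.map_cons, wickSum, ih]
    simp only [List.length_cons]
    rw [Fin.sum_univ_succ]
    simp [incrementLetter, max_eq_right h, mul_assoc]

end Words

section LevySystem

variable {n : ℕ} {A : Type*} [Ring A] [Algebra ℂ A] [StarRing A] [StarModule ℂ A]

/-- The hypotheses of the free Paul Lévy theorem. -/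
structure LevySystem (τ : A →ₗ[ℂ] ℂ) (Bfil : ℝ → StarSubalgebra ℂ A) (Efam : ℝ → (A →ₗ[ℂ] A))
    (B : StarSubalgebra ℂ A) (EB : A →ₗ[ℂ] A) (η : Fin n → Fin n → (A →ₗ[ℂ] A))
    (Z : ℝ → Fin n → A) : Prop extends IsPosTrace τ where
  faithful : ∀ a : A, τ (star a * a) = 0 → a = 0
  mono : ∀ s t : ℝ, s ≤ t → Bfil s ≤ Bfil t
  E_mem : ∀ s x, Efam s x ∈ Bfil s
  E_fix : ∀ s, ∀ x ∈ Bfil s, Efam s x = x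
  E_bimod : ∀ s (a b : A), a ∈ Bfil s → b ∈ Bfil s → ∀ x, Efam s (a * x * b) = a * Efam s x * b
  E_trace : ∀ s x, τ (Efam s x) = τ x
  base_le : B ≤ Bfil 0
  EB_mem : ∀ x, EB x ∈ B
  EB_bimod : ∀ (a b : A), a ∈ B → b ∈ B → ∀ x, EB (a * x * b) = a * EB x * b
  EB_trace : ∀ x, τ (EB x) = τ x
  η_mem : ∀ i j, ∀ b ∈ B, η i j b ∈ B
  η_symm : ∀ i j, ∀ x ∈ B, ∀ y ∈ B, τ (η i j x * y) = τ (x * η j i y)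
  zero : ∀ j, Z 0 j = 0
  selfAdjoint : ∀ s, 0 ≤ s → ∀ j, star (Z s j) = Z s j
  adapted : ∀ s, 0 ≤ s → ∀ j, Z s j ∈ Bfil s
  martingale : ∀ s t : ℝ, 0 ≤ s → s ≤ t → ∀ j, Efam s (Z t j) = Z s j
  increment : ∃ (U V : ℝ → ℝ → Fin n → A) (K : ℝ), ∀ s t : ℝ, 0 ≤ s → s ≤ t → ∀ j,
      Z t j - Z s j = U t s j + V t s j ∧
      (τ ((star (U t s j) * U t s j) * (star (U t s j) * U t s j))).re
        ≤ K * (t - s) ^ ((3:ℝ)/2) ∧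
      (τ (star (V t s j) * V t s j)).re ≤ K * (t - s) ^ 2
  covariance : ∀ (s : ℝ), 0 ≤ s → ∀ (k l : Fin n) (a b : A), a ∈ Bfil s → b ∈ Bfil s →
      Tendsto (fun t : ℝ =>
          ‖τ (Z t k * a * Z t l * b) - τ (Z s k * a * Z s l * b)
            - ((t - s : ℝ) : ℂ) * τ (a * η l k (EB b))‖ / (t - s))
        (𝓝[>] s) (𝓝 0)

namespace LevySystem

variable {τ : A →ₗ[ℂ] ℂ} {Bfil : ℝ → StarSubalgebra ℂ A} {Efam : ℝ → (A →ₗ[ℂ] A)}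
  {B : StarSubalgebra ℂ A} {EB : A →ₗ[ℂ] A} {η : Fin n → Fin n → (A →ₗ[ℂ] A)}
  {Z : ℝ → Fin n → A}

theorem ext_of_trace (H : LevySystem τ Bfil Efam B EB η Z) (S : StarSubalgebra ℂ A) {x y : A}
    (hx : x ∈ S) (hy : y ∈ S) (h : ∀ c ∈ S, τ (c * x) = τ (c * y)) : x = y := by
  refine sub_eq_zero.1 (H.faithful _ ?_)
  rw [mul_sub, map_sub, h _ (star_mem (sub_mem hx hy)), sub_self]

theorem E_mul_left (H : LevySystem τ Bfil Efam B EB η Z) {t : ℝ} {a : A} (ha : a ∈ Bfil t)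
    (x : A) : Efam t (a * x) = a * Efam t x := by
  simpa using H.E_bimod t a 1 ha (one_mem _) x

theorem trace_mul_E (H : LevySystem τ Bfil Efam B EB η Z) {t : ℝ} {a : A} (ha : a ∈ Bfil t)
    (x : A) : τ (a * Efam t x) = τ (a * x) := by
  rw [← H.E_mul_left ha, H.E_trace]

theorem trace_mul_EB (H : LevySystem τ Bfil Efam B EB η Z) {a : A} (ha : a ∈ B) (x : A) :
    τ (a * EB x) = τ (a * x) := by
  have := H.EB_bimod a 1 ha (one_mem _) x
  rw [mul_one, mul_one] at this
  rw [← this, H.EB_trace]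

theorem base_le_fil (H : LevySystem τ Bfil Efam B EB η Z) {t : ℝ} (ht : 0 ≤ t) : B ≤ Bfil t :=
  H.base_le.trans (H.mono 0 t ht)

theorem EB_E (H : LevySystem τ Bfil Efam B EB η Z) {t : ℝ} (ht : 0 ≤ t) (x : A) :
    EB (Efam t x) = EB x := by
  refine H.ext_of_trace B (H.EB_mem _) (H.EB_mem _) fun c hc => ?_
  rw [H.trace_mul_EB hc, H.trace_mul_EB hc, H.trace_mul_E (H.base_le_fil ht hc)]

theorem η_EB_mem (H : LevySystem τ Bfil Efam B EB η Z) {t : ℝ} (ht : 0 ≤ t) (i j : Fin n)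
    (x : A) : η i j (EB x) ∈ Bfil t :=
  H.base_le_fil ht (H.η_mem i j _ (H.EB_mem x))

theorem adapted_of_le (H : LevySystem τ Bfil Efam B EB η Z) {s t : ℝ} (hs : 0 ≤ s) (hst : s ≤ t)
    (j : Fin n) : Z s j ∈ Bfil t :=
  H.mono s t hst (H.adapted s hs j)

/-- An increment after time `s` is centred relative to `Bfil s`. -/
theorem E_mul_increment_mul (H : LevySystem τ Bfil Efam B EB η Z) {s t : ℝ} (hs : 0 ≤ s)
    (hst : s ≤ t) (j : Fin n) {a b : A} (ha : a ∈ Bfil s) (hb : b ∈ Bfil s) :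
    Efam s (a * (Z t j - Z s j) * b) = 0 := by
  rw [H.E_bimod s a b ha hb, map_sub, H.martingale s t hs hst,
    H.E_fix s _ (H.adapted s hs j), sub_self, mul_zero, zero_mul]

theorem trace_mul_increment_mul (H : LevySystem τ Bfil Efam B EB η Z) {s t : ℝ} (hs : 0 ≤ s)
    (hst : s ≤ t) (j : Fin n) {a b : A} (ha : a ∈ Bfil s) (hb : b ∈ Bfil s) :
    τ (a * (Z t j - Z s j) * b) = 0 := by
  rw [← H.E_trace s, H.E_mul_increment_mul hs hst j ha hb, map_zero]

theorem EB_mul_increment_mul (H : LevySystem τ Bfil Efam B EB η Z) {s t : ℝ} (hs : 0 ≤ s)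
    (hst : s ≤ t) (j : Fin n) {a b : A} (ha : a ∈ Bfil s) (hb : b ∈ Bfil s) :
    EB (a * (Z t j - Z s j) * b) = 0 := by
  rw [← H.EB_E hs, H.E_mul_increment_mul hs hst j ha hb, map_zero]

/-! ### Bounds for the increments -/

theorem exists_traceNorm_increment_le (H : LevySystem τ Bfil Efam B EB η Z) :
    ∃ (U V : ℝ → ℝ → Fin n → A) (C : ℝ), ∀ s t : ℝ, 0 ≤ s → s ≤ t → ∀ j,
      Z t j - Z s j = U t s j + V t s j ∧
      traceNorm τ (star (U t s j) * U t s j) ≤ C * (t - s) ^ (3 / 4 : ℝ) ∧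
      traceNorm τ (V t s j) ≤ C * (t - s) := by
  obtain ⟨U, V, K, h⟩ := H.increment
  refine ⟨U, V, √K, fun s t hs hst j => ?_⟩
  obtain ⟨h1, h2, h3⟩ := h s t hs hst j
  have hts : 0 ≤ t - s := sub_nonneg.2 hst
  refine ⟨h1, ?_, ?_⟩
  · have e : (t - s) ^ (3 / 4 : ℝ) = √((t - s) ^ (3 / 2 : ℝ)) := by
      rw [Real.sqrt_eq_rpow, ← Real.rpow_mul hts]; norm_num
    rw [e, ← Real.sqrt_mul' _ (Real.rpow_nonneg hts _), traceNorm]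
    refine Real.sqrt_le_sqrt ?_
    simpa [mul_assoc] using h2
  · have e : √K * (t - s) = √(K * (t - s) ^ 2) := by
      rw [Real.sqrt_mul' _ (sq_nonneg _), Real.sqrt_sq hts]
    rw [e]
    exact Real.sqrt_le_sqrt h3

theorem exists_traceNorm_sub_le (H : LevySystem τ Bfil Efam B EB η Z) :
    ∃ C : ℝ, 0 ≤ C ∧ ∀ s t : ℝ, 0 ≤ s → s ≤ t → ∀ j,
      traceNorm τ (Z t j - Z s j) ≤ C * √((t - s) ^ (3 / 4 : ℝ)) + C * (t - s) := by
  obtain ⟨U, V, C, h⟩ := H.exists_traceNorm_increment_le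
  refine ⟨max |C| √(traceNorm τ 1 * |C|), le_max_of_le_left (abs_nonneg _),
    fun s t hs hst j => ?_⟩
  obtain ⟨h1, h2, h3⟩ := h s t hs hst j
  have hts : 0 ≤ t - s := sub_nonneg.2 hst
  rw [h1]
  refine (H.traceNorm_add_le _ _).trans (add_le_add ?_ ?_)
  · refine le_trans ?_ (mul_le_mul_of_nonneg_right (le_max_right _ _) (Real.sqrt_nonneg _))
    rw [← Real.sqrt_mul' _ (Real.rpow_nonneg hts _)]
    refine Real.le_sqrt_of_sq_le ?_
    rw [H.sq_traceNorm, mul_assoc]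
    have := H.norm_map_mul_le 1 (star (U t s j) * U t s j)
    rw [one_mul] at this
    refine this.trans (mul_le_mul_of_nonneg_left (h2.trans ?_) (IsPosTrace.traceNorm_nonneg _))
    exact mul_le_mul_of_nonneg_right (le_abs_self C) (Real.rpow_nonneg hts _)
  · exact h3.trans (mul_le_mul_of_nonneg_right ((le_abs_self C).trans (le_max_left _ _)) hts)

theorem continuousOn_trace_mul (H : LevySystem τ Bfil Efam B EB η Z) (j : Fin n) (a x : A) :
    ContinuousOn (fun s => τ (a * Z s j * x)) (Set.Ici 0) := by
  obtain ⟨C, hC, h⟩ := H.exists_traceNorm_sub_le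
  have h' : ∀ s t : ℝ, 0 ≤ s → 0 ≤ t → ‖τ (a * Z t j * x) - τ (a * Z s j * x)‖ ≤
      (C * √(|t - s| ^ (3 / 4 : ℝ)) + C * |t - s|) * traceNorm τ (x * a) := by
    intro s t hs ht
    have e : τ (a * Z t j * x) - τ (a * Z s j * x) = τ ((Z t j - Z s j) * (x * a)) := by
      rw [mul_assoc, mul_assoc, H.comm a, H.comm a, sub_mul, map_sub, mul_assoc, mul_assoc]
    rw [e]
    refine (H.norm_map_mul_le _ _).trans
      (mul_le_mul_of_nonneg_right ?_ (IsPosTrace.traceNorm_nonneg _))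
    rcases le_total s t with hst | hst
    · rw [abs_of_nonneg (sub_nonneg.2 hst)]; exact h s t hs hst j
    · rw [abs_sub_comm, abs_of_nonneg (sub_nonneg.2 hst)]
      refine le_trans (le_of_eq ?_) (h t s ht hst j)
      rw [traceNorm, traceNorm, ← neg_sub (Z s j), star_neg, neg_mul_neg]
  intro s hs
  rw [ContinuousWithinAt, tendsto_iff_norm_sub_tendsto_zero]
  refine squeeze_zero' (Eventually.of_forall fun _ => norm_nonneg _)
    (eventually_nhdsWithin_of_forall fun t ht => h' s t hs ht) ?_
  have hc : Continuous fun t : ℝ =>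
      (C * √(|t - s| ^ (3 / 4 : ℝ)) + C * |t - s|) * traceNorm τ (x * a) := by
    have : Continuous fun t : ℝ => |t - s| ^ (3 / 4 : ℝ) :=
      (continuous_abs.comp (continuous_id.sub continuous_const)).rpow_const
        fun _ => Or.inr (by norm_num)
    fun_prop
  have := (hc.tendsto s).mono_left (nhdsWithin_le_nhds (s := Set.Ici 0))
  simpa using this

/-! ### The filter `𝓝[>] r` -/

theorem eventually_increment {r : ℝ} : ∀ᶠ t in 𝓝[>] r, 0 < t - r ∧ t - r ≤ 1 := by
  filter_upwards [Ioc_mem_nhdsGT (show r < r + 1 by linarith)] with t ht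
  exact ⟨by linarith [ht.1], by linarith [ht.2]⟩

theorem process_mem_boundedFamilies (H : LevySystem τ Bfil Efam B EB η Z) {r : ℝ} (hr : 0 ≤ r)
    (j : Fin n) : (fun t => Z t j) ∈ boundedFamilies τ (𝓝[>] r) := by
  refine StarAlgebra.subset_adjoin _ _ fun k => ?_
  refine Asymptotics.IsBigO.of_bound ‖τ (Z (r + 1) j ^ 2 ^ (k + 1))‖ ?_
  filter_upwards [eventually_increment] with t ht
  have ht0 : 0 ≤ t := by linarith
  have e : (Z t j * star (Z t j)) ^ 2 ^ k = Z t j ^ 2 ^ (k + 1) := by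
    rw [H.selfAdjoint t ht0, ← pow_two, ← pow_mul, pow_succ, mul_comm]
  rw [e, norm_one, mul_one]
  refine H.norm_map_pow_le (H.selfAdjoint _ (by linarith) j) (H.selfAdjoint t ht0 j) k ?_
  rw [← H.trace_mul_E (pow_mem (H.adapted t ht0 j) _), H.martingale t _ ht0 (by linarith),
    ← pow_succ, Nat.sub_add_cancel Nat.one_le_two_pow]

theorem isLittleO_trace_triple (H : LevySystem τ Bfil Efam B EB η Z) {r : ℝ} (hr : 0 ≤ r)
    (i j k : Fin n) {x y z : ℝ → A} (hx : x ∈ boundedFamilies τ (𝓝[>] r))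
    (hy : y ∈ boundedFamilies τ (𝓝[>] r)) (hz : z ∈ boundedFamilies τ (𝓝[>] r)) :
    (fun t => τ ((Z t i - Z r i) * x t * (Z t j - Z r j) * (y t * (Z t k - Z r k) * z t)))
      =o[𝓝[>] r] (fun t => t - r) := by
  obtain ⟨U, V, C, h⟩ := H.exists_traceNorm_increment_le
  have hl : Tendsto (fun t => t - r) (𝓝[>] r) (𝓝 0) := by
    have : Continuous fun t : ℝ => t - r := by fun_prop
    simpa using (this.tendsto r).mono_left (nhdsWithin_le_nhds (s := Set.Ioi r))
  have hD : ∀ i, (fun t => Z t i - Z r i) ∈ boundedFamilies τ (𝓝[>] r) := fun i =>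
    sub_mem (H.process_mem_boundedFamilies hr i) (const_mem_boundedFamilies (Z r i))
  have hsa : ∀ i, ∀ᶠ t in 𝓝[>] r, star (Z t i - Z r i) = Z t i - Z r i := by
    intro i
    filter_upwards [eventually_increment] with t ht
    rw [star_sub, H.selfAdjoint r hr, H.selfAdjoint t (by linarith)]
  have hb := fun i => H.isBigO_traceNorm_sq eventually_increment (hD i) (hsa i)
    (U := fun t => U t r i) (V := fun t => V t r i)
    (by
      filter_upwards [eventually_increment] with t ht
      exact (h r t hr (by linarith) i).1)
    (by
      refine Asymptotics.IsBigO.of_bound C ?_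
      filter_upwards [eventually_increment] with t ht
      rw [Real.norm_of_nonneg (IsPosTrace.traceNorm_nonneg _),
        Real.norm_of_nonneg (Real.rpow_nonneg ht.1.le _)]
      exact (h r t hr (by linarith) i).2.1)
    (by
      refine Asymptotics.IsBigO.of_bound C ?_
      filter_upwards [eventually_increment] with t ht
      rw [Real.norm_of_nonneg (IsPosTrace.traceNorm_nonneg _), Real.rpow_one,
        Real.norm_of_nonneg ht.1.le]
      exact (h r t hr (by linarith) i).2.2)
  exact H.isLittleO_triple eventually_increment hl hD hsa (fun i => (hb i).1) (fun i => (hb i).2)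
    i j k hx hy hz

/-! ### Tame families -/

/-- Families in `S` which, on the right of `r`, are combinations of fixed elements of `S` whose
coefficients are right continuous at `r`. -/
inductive IsTame (S : StarSubalgebra ℂ A) (r : ℝ) : (ℝ → A) → Prop
  | const {a : A} (ha : a ∈ S) : IsTame S r (fun _ => a)
  | smul {g : ℝ → ℂ} {f : ℝ → A} (hg : ContinuousWithinAt g (Set.Ici r) r) (hf : IsTame S r f) :
      IsTame S r (fun t => g t • f t)
  | add {f g : ℝ → A} (hf : IsTame S r f) (hg : IsTame S r g) : IsTame S r (fun t => f t + g t)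
  | congr {f g : ℝ → A} (hf : IsTame S r f) (h : f =ᶠ[𝓝[≥] r] g) : IsTame S r g

theorem IsTame.eventually_mem {S : StarSubalgebra ℂ A} {r : ℝ} {f : ℝ → A} (hf : IsTame S r f) :
    ∀ᶠ t in 𝓝[≥] r, f t ∈ S := by
  induction hf with
  | const ha => exact Eventually.of_forall fun _ => ha
  | smul hg hf ih => exact ih.mono fun t ht => S.smul_mem ht _
  | add hf hg ihf ihg => filter_upwards [ihf, ihg] with t h1 h2 using add_mem h1 h2
  | congr hf h ih => filter_upwards [ih, h] with t h1 h2 using h2 ▸ h1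

theorem IsTame.map {S : StarSubalgebra ℂ A} {r : ℝ} {f : ℝ → A} (hf : IsTame S r f)
    (L : A →ₗ[ℂ] A) (hL : ∀ x ∈ S, L x ∈ S) : IsTame S r (fun t => L (f t)) := by
  induction hf with
  | const ha => exact .const (hL _ ha)
  | smul hg hf ih => simpa using ih.smul hg
  | add hf hg ihf ihg => simpa using ihf.add ihg
  | congr hf h ih => exact ih.congr (h.fun_comp L)

theorem IsTame.mul {S : StarSubalgebra ℂ A} {r : ℝ} {f g : ℝ → A} (hf : IsTame S r f)
    (hg : IsTame S r g) : IsTame S r (fun t => f t * g t) := by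
  induction hf with
  | const ha =>
    exact hg.map (LinearMap.mulLeft ℂ _) fun x hx => mul_mem ha hx
  | smul hc hf ih => simpa using ih.smul hc
  | add hf hg ihf ihg => simpa [add_mul] using ihf.add ihg
  | congr hf h ih => exact ih.congr (h.mul .rfl)

/-- The infinitesimal covariance, for words in two increments. -/
theorem tendsto_trace_increment (H : LevySystem τ Bfil Efam B EB η Z) {r : ℝ} (hr : 0 ≤ r)
    (k l : Fin n) {x y : ℝ → A} (hx : IsTame (Bfil r) r x) (hy : IsTame (Bfil r) r y) {b : A}
    (hb : b ∈ Bfil r) :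
    Tendsto (fun t => ((t - r : ℝ) : ℂ)⁻¹ *
        τ (b * ((Z t k - Z r k) * (x t * ((Z t l - Z r l) * y t)))))
      (𝓝[>] r) (𝓝 (τ (b * (η k l (EB (x r)) * y r)))) := by
  have hle : 𝓝[>] r ≤ 𝓝[≥] r := nhdsWithin_mono _ Set.Ioi_subset_Ici_self
  induction hx with
  | @const a ha =>
    induction hy with
    | @const c hc =>
      rw [tendsto_iff_norm_sub_tendsto_zero]
      refine (H.covariance r hr k l a (c * b) ha (mul_mem hc hb)).congr' ?_
      filter_upwards [eventually_increment] with t ht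
      have hrt : r ≤ t := by linarith
      have hcb := mul_mem hc hb
      have e1 : τ (Z t k * a * Z r l * (c * b)) = τ (Z r k * a * Z r l * (c * b)) := by
        have := H.trace_mul_increment_mul hr hrt k (one_mem _)
          (mul_mem (mul_mem ha (H.adapted r hr l)) hcb)
        rw [one_mul, sub_mul, map_sub, sub_eq_zero] at this
        simpa only [mul_assoc] using this
      have e2 : τ (Z r k * a * Z t l * (c * b)) = τ (Z r k * a * Z r l * (c * b)) := by
        have := H.trace_mul_increment_mul hr hrt l (mul_mem (H.adapted r hr k) ha) hcb
        rwa [mul_sub, sub_mul, map_sub, sub_eq_zero] at this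
      have e3 : τ (b * ((Z t k - Z r k) * (a * ((Z t l - Z r l) * c)))) =
          τ (Z t k * a * Z t l * (c * b)) - τ (Z r k * a * Z r l * (c * b)) := by
        have : (Z t k - Z r k) * (a * ((Z t l - Z r l) * c)) * b =
            Z t k * a * Z t l * (c * b) - Z t k * a * Z r l * (c * b) -
              (Z r k * a * Z t l * (c * b) - Z r k * a * Z r l * (c * b)) := by
          noncomm_ring
        rw [H.comm, this, map_sub, map_sub, map_sub, e1, e2]
        ring
      have e4 : τ (a * η l k (EB (c * b))) = τ (b * (η k l (EB a) * c)) := by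
        rw [H.comm, ← H.trace_mul_EB (H.η_mem l k _ (H.EB_mem _)),
          H.η_symm l k _ (H.EB_mem _) _ (H.EB_mem _), H.comm,
          H.trace_mul_EB (H.η_mem k l _ (H.EB_mem _)), ← mul_assoc, H.comm]
      have h0 : ((t - r : ℝ) : ℂ) ≠ 0 := by exact_mod_cast ht.1.ne'
      rw [e3, e4]
      set X := τ (Z t k * a * Z t l * (c * b)) - τ (Z r k * a * Z r l * (c * b))
      set Y := τ (b * (η k l (EB a) * c))
      have : ((t - r : ℝ) : ℂ)⁻¹ * X - Y = ((t - r : ℝ) : ℂ)⁻¹ * (X - ((t - r : ℝ) : ℂ) * Y) := by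
        field_simp
      rw [this, norm_mul, norm_inv, Complex.norm_real, Real.norm_of_nonneg ht.1.le]
      ring
    | smul hg hf ih =>
      refine ((hg.mono_left hle).mul ih).congr' (Eventually.of_forall fun t => ?_) |>.trans_eq ?_
      · simp [mul_left_comm]
      · simp
    | add hf hg ihf ihg =>
      refine ((ihf.add ihg).congr' (Eventually.of_forall fun t => ?_)).trans_eq ?_
      · simp [mul_add]
      · simp [mul_add]
    | congr hf h ih =>
      rw [← h.self_of_nhdsWithin Set.self_mem_Ici]
      exact ih.congr' ((h.filter_mono hle).mono fun t ht => by rw [ht])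
  | smul hg hf ih =>
    refine ((hg.mono_left hle).mul ih).congr' (Eventually.of_forall fun t => ?_) |>.trans_eq ?_
    · simp [mul_left_comm]
    · simp
  | add hf hg ihf ihg =>
    refine ((ihf.add ihg).congr' (Eventually.of_forall fun t => ?_)).trans_eq ?_
    · simp [mul_add, add_mul]
    · simp [mul_add, add_mul]
  | congr hf h ih =>
    rw [← h.self_of_nhdsWithin Set.self_mem_Ici]
    exact ih.congr' ((h.filter_mono hle).mono fun t ht => by rw [ht])

/-! ### Words whose letters do not see the increment of the process after `r` -/

theorem isAdaptedWord_skipIncrement (H : LevySystem τ Bfil Efam B EB η Z) {r t : ℝ} (hr : 0 ≤ r)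
    (hrt : r ≤ t) {w : List (Letter n A)} (hw : IsAdaptedWord (Bfil r : Set A) w) :
    IsAdaptedWord (Bfil t : Set A) (w.map (skipIncrement Z r t)) := by
  intro p hp
  obtain ⟨q, hq, rfl⟩ := List.mem_map.1 hp
  obtain ⟨h1, h2, h3⟩ := hw q hq
  refine ⟨by simpa using h1, ?_, by simpa using H.mono r t hrt h3⟩
  rw [skipIncrement]
  split_ifs
  · exact add_mem (H.mono r t hrt h2)
      (sub_mem (H.adapted t (hr.trans hrt) _) (H.adapted_of_le hr hrt _))
  · exact H.mono r t hrt h2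

theorem eval_mem_of_le (H : LevySystem τ Bfil Efam B EB η Z) {r : ℝ} {p : Letter n A}
    (hp : 0 ≤ p.time ∧ p.shift ∈ Bfil r ∧ p.coef ∈ Bfil r) (h : p.time ≤ r) :
    p.eval Z ∈ Bfil r :=
  mul_mem (sub_mem (H.adapted_of_le hp.1 h _) hp.2.1) hp.2.2

/-- The free Wick recursion for words with fewer than `N` letters. -/
def WickBelow (Bfil : ℝ → StarSubalgebra ℂ A) (Efam : ℝ → (A →ₗ[ℂ] A)) (EB : A →ₗ[ℂ] A)
    (η : Fin n → Fin n → (A →ₗ[ℂ] A)) (Z : ℝ → Fin n → A) (N : ℕ) : Prop :=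
  ∀ t : ℝ, 0 ≤ t → ∀ w : List (Letter n A), w.length < N → IsAdaptedWord (Bfil t : Set A) w →
    ∀ s : ℝ, t ≤ s → ∀ j, ∀ c ∈ Bfil t,
      Efam t ((Z s j - Z t j) * (c * evalWord Z w)) =
        wickSum Z (fun q => (η j q).comp EB) (Efam t) (fun p => max 0 (min s p.time - t)) c w

theorem isTame_wickSum (H : LevySystem τ Bfil Efam B EB η Z) {r : ℝ} (hr : 0 ≤ r)
    (s : ℝ) (j : Fin n) {c : A} (hc : c ∈ Bfil r) (v u : List (Letter n A))
    (hv : IsAdaptedWord (Bfil r : Set A) v)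
    (ih : ∀ w : List (Letter n A), w.length ≤ (u ++ v).length → w ⊆ u ++ v → ∀ c ∈ Bfil r,
      IsTame (Bfil r) r (fun t => Efam t (c * evalWord Z (w.map (skipIncrement Z r t))))) :
    IsTame (Bfil r) r (fun t => wickSum Z (fun q => (η j q).comp EB) (Efam t)
      (fun p => max 0 (min s p.time - t)) (c * evalWord Z (u.map (skipIncrement Z r t)))
      (v.map (skipIncrement Z r t))) := by
  induction v generalizing u with
  | nil => simpa [wickSum] using IsTame.const (zero_mem (Bfil r))
  | cons p v ihv =>
    rw [isAdaptedWord_cons] at hv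
    simp only [List.map_cons, wickSum, skipIncrement_idx, skipIncrement_time, skipIncrement_coef,
      LinearMap.comp_apply]
    refine .add (.smul (g := fun t => ((max 0 (min s p.time - t) : ℝ) : ℂ)) ?_ (.mul ?_ ?_)) ?_
    · exact Continuous.continuousWithinAt (by fun_prop)
    · refine ((ih u (by simp) (by simp) c hc).map ((η j p.idx).comp EB)
        fun x _ => H.η_EB_mem hr _ _ x).congr ?_
      filter_upwards [self_mem_nhdsWithin] with t ht
      rw [LinearMap.comp_apply, H.EB_E (hr.trans ht)]
    · exact ih v (by simp; omega) (by simp) _ hv.1.2.2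
    · have := ihv (u ++ [p]) hv.2 (by simpa using ih)
      simpa [mul_assoc] using this

/-- The conditional expectations on `Bfil t` of a word free of the increment are tame. -/
theorem isTame_E (H : LevySystem τ Bfil Efam B EB η Z) {r : ℝ} (hr : 0 ≤ r) {N : ℕ}
    (hN : WickBelow Bfil Efam EB η Z N) (w : List (Letter n A)) (hwN : w.length ≤ N)
    (hw : IsAdaptedWord (Bfil r : Set A) w) {c : A} (hc : c ∈ Bfil r) :
    IsTame (Bfil r) r (fun t => Efam t (c * evalWord Z (w.map (skipIncrement Z r t)))) := by
  induction hm : w.length using Nat.strong_induction_on generalizing w c with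
  | _ m ih =>
  cases w with
  | nil =>
    refine (IsTame.const hc).congr ?_
    filter_upwards [self_mem_nhdsWithin] with t ht
    simp [H.E_fix t c (H.mono r t ht hc)]
  | cons p w =>
    rw [isAdaptedWord_cons] at hw
    simp only [List.length_cons] at hm hwN
    rcases le_or_gt p.time r with hp | hp
    · have := ih w.length (by omega) w (by omega) hw.2
        (mul_mem hc (H.eval_mem_of_le hw.1 hp)) rfl
      simpa [skipIncrement_of_le hp, mul_assoc] using this
    · have h1 := ih w.length (by omega) w (by omega) hw.2
        (mul_mem hc (mul_mem (sub_mem (H.adapted r hr p.idx) hw.1.2.1) hw.1.2.2)) rfl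
      have h2 := H.isTame_wickSum hr p.time p.idx hw.1.2.2 w [] hw.2 (by
        intro v hv hvw d hd
        exact ih v.length (by simp at hv; omega) v (by simp at hv; omega)
          (fun q hq => hw.2 q (hvw hq)) hd rfl)
      refine (((IsTame.const hc).mul h2).add h1).congr ?_
      filter_upwards [Ico_mem_nhdsGE hp] with t ht
      have hc' := H.mono r t ht.1 hc
      have := hN t (hr.trans ht.1) (w.map (skipIncrement Z r t)) (by simp; omega)
        (H.isAdaptedWord_skipIncrement hr ht.1 hw.2) p.time ht.2.le p.idx p.coef
        (H.mono r t ht.1 hw.1.2.2)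
      simp only [List.map_nil, evalWord_nil, mul_one]
      rw [← this, ← H.E_mul_left hc', ← map_add, List.map_cons, evalWord_cons,
        eval_skipIncrement_of_lt hp]
      congr 1
      noncomm_ring

/-! ### Words which contain the increment -/

theorem eventually_trace_increment_word (H : LevySystem τ Bfil Efam B EB η Z) {r : ℝ} (hr : 0 ≤ r)
    {N : ℕ} (hN : WickBelow Bfil Efam EB η Z N) {w : List (Letter n A)} (hwN : w.length ≤ N)
    (hw : IsAdaptedWord (Bfil r : Set A) w) {b c : A} (hb : b ∈ Bfil r) (hc : c ∈ Bfil r)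
    (j : Fin n) :
    ∀ᶠ t in 𝓝[>] r, τ (b * ((Z t j - Z r j) *
      (c * evalWord Z (w.map (skipIncrement Z r t))))) = 0 := by
  filter_upwards [(H.isTame_E hr hN w hwN hw hc).eventually_mem.filter_mono
    (nhdsWithin_mono _ Set.Ioi_subset_Ici_self), self_mem_nhdsWithin] with t ht hrt
  have hrt : r ≤ t := le_of_lt hrt
  have hbD : b * (Z t j - Z r j) ∈ Bfil t := mul_mem (H.mono r t hrt hb)
    (sub_mem (H.adapted t (hr.trans hrt) j) (H.adapted_of_le hr hrt j))
  rw [← mul_assoc, ← H.trace_mul_E hbD, H.trace_mul_increment_mul hr hrt j hb ht]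

theorem evalWord_insert_increment (H : LevySystem τ Bfil Efam B EB η Z) (r t : ℝ) (k : Fin n)
    (c : A) (u v : List (Letter n A)) :
    evalWord Z (u ++ ⟨0, k, -(Z t k - Z r k), c⟩ :: v) =
      evalWord Z u * ((Z t k - Z r k) * (c * evalWord Z v)) := by
  simp [Letter.eval, H.zero, mul_assoc]

theorem eventually_wickSum_factor (H : LevySystem τ Bfil Efam B EB η Z) {r : ℝ} (hr : 0 ≤ r)
    {N : ℕ} (hN : WickBelow Bfil Efam EB η Z N) (s : ℝ) (j k : Fin n) {c c' : A} (hc : c ∈ Bfil r)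
    (hc' : c' ∈ Bfil r) {v : List (Letter n A)} (hvN : v.length ≤ N)
    (hv : IsAdaptedWord (Bfil r : Set A) v) (u pre : List (Letter n A))
    (hN' : (pre ++ u).length ≤ N) (hu : IsAdaptedWord (Bfil r : Set A) (pre ++ u))
    (ih : ∀ w : List (Letter n A), w.length ≤ (pre ++ u).length → w ⊆ pre ++ u → ∀ m,
      ∀ c ∈ Bfil r, ∀ᶠ t in 𝓝[>] r,
        Efam t (c * (evalWord Z (w.map (skipIncrement Z r t)) * ((Z t k - Z r k) *
          (c' * evalWord Z ((v.take m).map (skipIncrement Z r t)))))) =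
        Efam t (c * evalWord Z (w.map (skipIncrement Z r t))) * ((Z t k - Z r k) *
          Efam t (c' * evalWord Z ((v.take m).map (skipIncrement Z r t))))) :
    ∀ᶠ t in 𝓝[>] r,
      wickSum Z (fun q => (η j q).comp EB) (Efam t) (fun p => max 0 (min s p.time - t))
        (c * evalWord Z (pre.map (skipIncrement Z r t)))
        (u.map (skipIncrement Z r t) ++ ⟨0, k, -(Z t k - Z r k), c'⟩ ::
          v.map (skipIncrement Z r t)) =
      wickSum Z (fun q => (η j q).comp EB) (Efam t) (fun p => max 0 (min s p.time - t))
        (c * evalWord Z (pre.map (skipIncrement Z r t))) (u.map (skipIncrement Z r t)) *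
        ((Z t k - Z r k) * Efam t (c' * evalWord Z (v.map (skipIncrement Z r t)))) := by
  have hle : 𝓝[>] r ≤ 𝓝[≥] r := nhdsWithin_mono _ Set.Ioi_subset_Ici_self
  induction u generalizing pre with
  | nil =>
    rw [List.append_nil] at hN' hu ih
    have h1 : ∀ᶠ t in 𝓝[>] r, ∀ m ∈ Finset.range v.length,
        EB (c * (evalWord Z (pre.map (skipIncrement Z r t)) * ((Z t k - Z r k) *
          (c' * evalWord Z ((v.take m).map (skipIncrement Z r t)))))) = 0 := by
      rw [Filter.eventually_all_finset]
      intro m _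
      filter_upwards [ih pre le_rfl (by simp) m c hc, self_mem_nhdsWithin,
        (H.isTame_E hr hN pre hN' hu hc).eventually_mem.filter_mono hle,
        (H.isTame_E hr hN (v.take m) ((List.length_take_le' _ _).trans hvN)
          (fun p hp => hv p (List.mem_of_mem_take hp)) hc').eventually_mem.filter_mono hle]
        with t ht hrt hx hy
      have hrt : r ≤ t := le_of_lt hrt
      rw [← H.EB_E (hr.trans hrt), ht, ← mul_assoc, H.EB_mul_increment_mul hr hrt k hx hy]
    filter_upwards [h1, self_mem_nhdsWithin] with t ht hrt
    have hrt : r < t := hrt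
    have h0 : max 0 (min s 0 - t) = 0 := max_eq_left (by linarith [min_le_right s 0])
    simp only [List.map_nil, List.nil_append, wickSum, zero_mul, h0, Complex.ofReal_zero, zero_smul,
      zero_add]
    refine wickSum_eq_zero fun m hm q => ?_
    rw [LinearMap.comp_apply, ← List.map_take]
    simpa [Letter.eval, H.zero, mul_assoc] using
      congrArg (η j q) (ht m (by simpa using hm))
  | cons p u ihu =>
    have hp : p.coef ∈ Bfil r := (hu p (by simp)).2.2
    have hi := ihu (pre ++ [p]) (by simpa using hN') (by simpa using hu) (by simpa using ih)
    filter_upwards [hi, ih u (by simp; omega) (by simp) v.length p.coef hp] with t h1 h2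
    rw [List.take_length] at h2
    simp only [List.map_append, List.map_cons, List.map_nil, evalWord_append, evalWord_cons,
      evalWord_nil, mul_one, ← mul_assoc c] at h1
    rw [List.map_cons, List.cons_append, wickSum, wickSum, h1, H.evalWord_insert_increment,
      skipIncrement_coef, h2, add_mul, smul_mul_assoc]
    simp only [mul_assoc]

/-- The conditional expectation of a word which contains the increment once factorizes. -/
theorem eventually_E_factor (H : LevySystem τ Bfil Efam B EB η Z) {r : ℝ} (hr : 0 ≤ r)
    {N : ℕ} (hN : WickBelow Bfil Efam EB η Z N) (k : Fin n) (u v : List (Letter n A))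
    (hlen : u.length + v.length < N) (hu : IsAdaptedWord (Bfil r : Set A) u)
    (hv : IsAdaptedWord (Bfil r : Set A) v) {c c' : A} (hc : c ∈ Bfil r) (hc' : c' ∈ Bfil r) :
    ∀ᶠ t in 𝓝[>] r,
      Efam t (c * (evalWord Z (u.map (skipIncrement Z r t)) * ((Z t k - Z r k) *
        (c' * evalWord Z (v.map (skipIncrement Z r t)))))) =
      Efam t (c * evalWord Z (u.map (skipIncrement Z r t))) * ((Z t k - Z r k) *
        Efam t (c' * evalWord Z (v.map (skipIncrement Z r t)))) := by
  induction hm : u.length using Nat.strong_induction_on generalizing u v c with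
  | _ m ih =>
  cases u with
  | nil =>
    filter_upwards [self_mem_nhdsWithin] with t hrt
    have hrt : r ≤ t := le_of_lt hrt
    have hct := H.mono r t hrt hc
    have hD : Z t k - Z r k ∈ Bfil t :=
      sub_mem (H.adapted t (hr.trans hrt) k) (H.adapted_of_le hr hrt k)
    simp only [List.map_nil, evalWord_nil, one_mul, mul_one]
    rw [H.E_mul_left hct, H.E_mul_left hD, H.E_fix t c hct]
  | cons p u =>
    rw [isAdaptedWord_cons] at hu
    simp only [List.length_cons] at hm hlen
    rcases le_or_gt p.time r with hp | hp
    · filter_upwards [ih u.length (by omega) u v (by omega) hu.2 hv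
        (mul_mem hc (H.eval_mem_of_le hu.1 hp)) rfl] with t ht
      simpa [skipIncrement_of_le hp, mul_assoc] using ht
    · have h1 := ih u.length (by omega) u v (by omega) hu.2 hv
        (mul_mem hc (mul_mem (sub_mem (H.adapted r hr p.idx) hu.1.2.1) hu.1.2.2)) rfl
      have h2 := H.eventually_wickSum_factor hr hN p.time p.idx k hu.1.2.2 hc' (v := v) (by omega)
        hv u [] (by simp; omega) (by simpa using hu.2) (by
          intro w hw hwu m d hd
          simp only [List.nil_append] at hw hwu
          have := List.length_take_le' m v
          exact ih w.length (by omega) w (v.take m) (by omega) (fun q hq => hu.2 q (hwu hq))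
            (fun q hq => hv q (List.mem_of_mem_take hq)) hd rfl)
      filter_upwards [h1, h2, Ioo_mem_nhdsGT hp] with t h1 h2 ht
      have hrt : r ≤ t := ht.1.le
      have hct := H.mono r t hrt hc
      have hD : Z t k - Z r k ∈ Bfil t :=
        sub_mem (H.adapted t (hr.trans hrt) k) (H.adapted_of_le hr hrt k)
      have hut := H.isAdaptedWord_skipIncrement hr hrt hu.2
      have hvt := H.isAdaptedWord_skipIncrement hr hrt hv
      have hW : IsAdaptedWord (Bfil t : Set A) (u.map (skipIncrement Z r t) ++
          ⟨0, k, -(Z t k - Z r k), c'⟩ :: v.map (skipIncrement Z r t)) :=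
        isAdaptedWord_append.2 ⟨hut, isAdaptedWord_cons.2
          ⟨⟨le_rfl, neg_mem hD, H.mono r t hrt hc'⟩, hvt⟩⟩
      have e1 := hN t (hr.trans hrt) _ (by simp; omega) hW p.time ht.2.le p.idx p.coef
        (H.mono r t hrt hu.1.2.2)
      have e2 := hN t (hr.trans hrt) _ (by simp; omega) hut p.time ht.2.le p.idx p.coef
        (H.mono r t hrt hu.1.2.2)
      simp only [List.map_nil, evalWord_nil, mul_one] at h2
      rw [h2, ← e2] at e1
      rw [H.evalWord_insert_increment] at e1
      have split : ∀ x, Efam t (c * ((skipIncrement Z r t p).eval Z * x)) =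
          c * Efam t ((Z p.time p.idx - Z t p.idx) * (p.coef * x)) +
          Efam t (c * ((Z r p.idx - p.shift) * p.coef) * x) := by
        intro x
        rw [← H.E_mul_left hct, ← map_add, eval_skipIncrement_of_lt hp]
        congr 1
        noncomm_ring
      rw [List.map_cons, evalWord_cons, mul_assoc ((skipIncrement Z r t p).eval Z), split, split,
        h1, e1]
      simp only [add_mul, mul_assoc]

/-- The infinitesimal covariance, for words which contain the increment twice. -/
theorem tendsto_trace_two_increments (H : LevySystem τ Bfil Efam B EB η Z) {r : ℝ} (hr : 0 ≤ r)
    {N : ℕ} (hN : WickBelow Bfil Efam EB η Z N) (k l : Fin n) {u v : List (Letter n A)}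
    (hlen : u.length + v.length < N) (hu : IsAdaptedWord (Bfil r : Set A) u)
    (hv : IsAdaptedWord (Bfil r : Set A) v) {b c c' : A} (hb : b ∈ Bfil r) (hc : c ∈ Bfil r)
    (hc' : c' ∈ Bfil r) :
    Tendsto (fun t => ((t - r : ℝ) : ℂ)⁻¹ *
        τ (b * ((Z t k - Z r k) * (c * (evalWord Z (u.map (skipIncrement Z r t)) *
          ((Z t l - Z r l) * (c' * evalWord Z (v.map (skipIncrement Z r t)))))))))
      (𝓝[>] r) (𝓝 (τ (b * (η k l (EB (c * evalWord Z u)) * (c' * evalWord Z v))))) := by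
  have h := H.tendsto_trace_increment hr k l (H.isTame_E hr hN u (by omega) hu hc)
    (H.isTame_E hr hN v (by omega) hv hc') hb
  have e : τ (b * (η k l (EB (c * evalWord Z u)) * (c' * evalWord Z v))) =
      τ (b * (η k l (EB (Efam r (c * evalWord Z (u.map (skipIncrement Z r r))))) *
        Efam r (c' * evalWord Z (v.map (skipIncrement Z r r))))) := by
    rw [H.EB_E hr, ← mul_assoc b, ← mul_assoc b,
      H.trace_mul_E (mul_mem hb (H.η_EB_mem hr _ _ _))]
    simp
  rw [e]
  refine h.congr' ?_
  filter_upwards [H.eventually_E_factor hr hN l u v hlen hu hv hc hc', self_mem_nhdsWithin]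
    with t ht hrt
  have hrt : r ≤ t := le_of_lt hrt
  have hbD : b * (Z t k - Z r k) ∈ Bfil t := mul_mem (H.mono r t hrt hb)
    (sub_mem (H.adapted t (hr.trans hrt) k) (H.adapted_of_le hr hrt k))
  rw [← mul_assoc b, ← ht, H.trace_mul_E hbD, mul_assoc b]

theorem evalWord_skipIncrement_mem (H : LevySystem τ Bfil Efam B EB η Z) {r : ℝ} (hr : 0 ≤ r)
    (w : List (Letter n A)) :
    (fun t => evalWord Z (w.map (skipIncrement Z r t))) ∈ boundedFamilies τ (𝓝[>] r) := by
  induction w with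
  | nil => exact const_mem_boundedFamilies 1
  | cons p w ih =>
    have hp : (fun t => (skipIncrement Z r t p).eval Z) ∈ boundedFamilies τ (𝓝[>] r) := by
      have : (fun t => (skipIncrement Z r t p).eval Z) = (fun _ => p.eval Z) -
          (if r < p.time then (fun t => Z t p.idx) - (fun _ => Z r p.idx) else 0) *
            (fun _ => p.coef) := by
        funext t
        have h := eval_eq_eval_skipIncrement (Z := Z) r t p
        split_ifs with hr <;> simp [h, hr]
      rw [this]
      refine sub_mem (const_mem_boundedFamilies _) (mul_mem ?_ (const_mem_boundedFamilies _))
      split_ifs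
      · exact sub_mem (H.process_mem_boundedFamilies hr _) (const_mem_boundedFamilies _)
      · exact zero_mem _
    simp only [List.map_cons, evalWord_cons]
    exact mul_mem hp ih

/-- In a word which contains two increments, the others may be skipped. -/
theorem isLittleO_trace_sub_skipIncrement (H : LevySystem τ Bfil Efam B EB η Z) {r : ℝ}
    (hr : 0 ≤ r) (i j : Fin n) {x y : ℝ → A} (hx : x ∈ boundedFamilies τ (𝓝[>] r))
    (hy : y ∈ boundedFamilies τ (𝓝[>] r)) (b : A) (w : List (Letter n A)) :
    (fun t => τ (b * ((Z t i - Z r i) * (x t * ((Z t j - Z r j) * (y t *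
      (evalWord Z w - evalWord Z (w.map (skipIncrement Z r t)))))))))
      =o[𝓝[>] r] (fun t => t - r) := by
  induction w generalizing y with
  | nil => simp
  | cons p w ih =>
    have hp : (fun t => (skipIncrement Z r t p).eval Z) ∈ boundedFamilies τ (𝓝[>] r) := by
      simpa using H.evalWord_skipIncrement_mem hr [p]
    have h1 := ih (mul_mem hy hp)
    have h2 : (fun t => τ (b * ((Z t i - Z r i) * (x t * ((Z t j - Z r j) * (y t *
        ((if r < p.time then Z t p.idx - Z r p.idx else 0) * (p.coef * evalWord Z w))))))))
        =o[𝓝[>] r] (fun t => t - r) := by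
      split_ifs
      · refine (H.isLittleO_trace_triple hr i j p.idx hx hy
          (const_mem_boundedFamilies (p.coef * evalWord Z w * b))).congr_left fun t => ?_
        rw [H.comm b]
        simp only [mul_assoc]
      · simp
    refine (h1.add h2).congr_left fun t => ?_
    rw [← map_add]
    congr 1
    rw [List.map_cons, evalWord_cons, evalWord_cons, eval_eq_eval_skipIncrement r t p]
    simp only [Pi.mul_apply]
    noncomm_ring

theorem isLittleO_trace_increment_mul (H : LevySystem τ Bfil Efam B EB η Z) {r : ℝ} (hr : 0 ≤ r)
    {N : ℕ} (hN : WickBelow Bfil Efam EB η Z N) (k : Fin n) (w u : List (Letter n A))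
    (hlen : u.length + w.length ≤ N) (hu : IsAdaptedWord (Bfil r : Set A) u)
    (hw : IsAdaptedWord (Bfil r : Set A) w) {b c : A} (hb : b ∈ Bfil r) (hc : c ∈ Bfil r) :
    (fun t => τ (b * ((Z t k - Z r k) * (c * (evalWord Z (u.map (skipIncrement Z r t)) *
        evalWord Z w)))) - ((t - r : ℝ) : ℂ) *
        τ (b * wickSum Z (fun q => (η k q).comp EB) .id (fun p => if r < p.time then 1 else 0)
          (c * evalWord Z u) w))
      =o[𝓝[>] r] (fun t => t - r) := by
  induction w generalizing u with
  | nil =>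
    refine (Asymptotics.isLittleO_zero _ _).congr' ?_ .rfl
    filter_upwards [H.eventually_trace_increment_word hr hN (by simpa using hlen) hu hb hc k]
      with t ht
    simp [wickSum, ht]
  | cons p w ih =>
    rw [isAdaptedWord_cons] at hw
    simp only [List.length_cons] at hlen
    have h1 := ih (u ++ [p]) (by simp; omega)
      (isAdaptedWord_append.2 ⟨hu, isAdaptedWord_cons.2 ⟨hw.1, fun _ h => by simp at h⟩⟩) hw.2
    have h2 : (fun t => τ (b * ((Z t k - Z r k) * (c * (evalWord Z (u.map (skipIncrement Z r t)) *
          ((if r < p.time then Z t p.idx - Z r p.idx else 0) * (p.coef * evalWord Z w)))))) -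
          ((t - r : ℝ) : ℂ) * (((if r < p.time then 1 else 0 : ℝ) : ℂ) *
          τ (b * (η k p.idx (EB (c * evalWord Z u)) * (p.coef * evalWord Z w)))))
        =o[𝓝[>] r] (fun t => t - r) := by
      split_ifs with hp
      · have ht := H.tendsto_trace_two_increments hr hN k p.idx (by omega) hu hw.2 hb hc hw.1.2.2
        rw [← tendsto_sub_nhds_zero_iff, ← Asymptotics.isLittleO_one_iff ℝ] at ht
        have h3 : (fun t : ℝ => ((t - r : ℝ) : ℂ)) =O[𝓝[>] r] (fun t => t - r) :=
          Asymptotics.IsBigO.of_bound 1 (Eventually.of_forall fun t => by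
            rw [one_mul, Complex.norm_real])
        have h4 := (h3.mul_isLittleO ht).congr_right fun t => mul_one _
        have h5 := H.isLittleO_trace_sub_skipIncrement hr k p.idx
          (mul_mem (const_mem_boundedFamilies c) (H.evalWord_skipIncrement_mem hr u))
          (const_mem_boundedFamilies p.coef) b w
        refine (h4.add h5).congr' ?_ .rfl
        filter_upwards [self_mem_nhdsWithin] with t ht
        have h0 : ((t - r : ℝ) : ℂ) ≠ 0 := by exact_mod_cast (sub_pos.2 ht).ne'
        rw [mul_sub, mul_inv_cancel_left₀ h0]
        simp only [Pi.mul_apply, mul_sub, map_sub, Complex.ofReal_one, one_mul, mul_assoc]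
        ring
      · simp
    refine (h1.add h2).congr_left fun t => ?_
    rw [wickSum, evalWord_cons, eval_eq_eval_skipIncrement r t p]
    simp only [List.map_append, List.map_cons, List.map_nil, evalWord_append, evalWord_cons,
      evalWord_nil, mul_one, add_mul, mul_add, map_add, mul_smul_comm, map_smul, smul_eq_mul,
      LinearMap.id_apply, LinearMap.comp_apply, mul_assoc]
    rw [eval_eq_eval_skipIncrement r t p]
    simp only [mul_add]
    ring

theorem E_wickSum (H : LevySystem τ Bfil Efam B EB η Z) {t : ℝ} (ht : 0 ≤ t) (j : Fin n)
    (φ : Letter n A → ℝ) (x : A) (w : List (Letter n A)) :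
    Efam t (wickSum Z (fun q => (η j q).comp EB) .id φ x w) =
      wickSum Z (fun q => (η j q).comp EB) (Efam t) φ x w := by
  induction w generalizing x with
  | nil => simp [wickSum]
  | cons p w ih =>
    simp only [wickSum, map_add, map_smul, LinearMap.comp_apply, LinearMap.id_apply, ih,
      H.E_mul_left (H.η_EB_mem ht j p.idx x)]

theorem trace_increment_mul_word (H : LevySystem τ Bfil Efam B EB η Z) {w : List (Letter n A)}
    (hN : WickBelow Bfil Efam EB η Z w.length) {t : ℝ} (ht : 0 ≤ t)
    (hw : IsAdaptedWord (Bfil t : Set A) w) {s : ℝ} (hts : t ≤ s) (j : Fin n) {b c : A}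
    (hb : b ∈ Bfil t) (hc : c ∈ Bfil t) :
    τ (b * ((Z s j - Z t j) * (c * evalWord Z w))) =
      τ (b * wickSum Z (fun q => (η j q).comp EB) .id (fun p => max 0 (min s p.time - t)) c w) := by
  set ζ : Fin n → A →ₗ[ℂ] A := fun q => (η j q).comp EB
  let G : ℝ → ℂ := fun r => τ (b * (Z r j * (c * evalWord Z w))) -
    τ (b * wickSum Z ζ .id (fun p => max 0 (min r p.time - t)) c w)
  have hcont : ContinuousOn G (Set.Icc t s) := by
    refine ContinuousOn.sub ?_ (continuous_wickSum τ ζ b c t w).continuousOn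
    have := (H.continuousOn_trace_mul j b (c * evalWord Z w)).mono
      (Set.Icc_subset_Ici_self.trans (Set.Ici_subset_Ici.2 ht) : Set.Icc t s ⊆ Set.Ici 0)
    simpa only [mul_assoc] using this
  have hderiv : ∀ r ∈ Set.Ico t s, HasDerivWithinAt G 0 (Set.Ici r) r := by
    intro r hr
    have h2 := hasDerivWithinAt_wickSum (Z := Z) τ ζ b c hr.1 w
    have h1 : HasDerivWithinAt (fun r => τ (b * (Z r j * (c * evalWord Z w))))
        (τ (b * wickSum Z ζ .id (fun p => if r < p.time then 1 else 0) c w)) (Set.Ici r) r := by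
      rw [← hasDerivWithinAt_Ioi_iff_Ici, hasDerivWithinAt_iff_isLittleO]
      have hm := H.mono t r hr.1
      refine (H.isLittleO_trace_increment_mul (ht.trans hr.1) hN j w [] (by simp)
        (fun _ h => by simp at h) (hw.mono hm) (hm hb) (hm hc)).congr_left fun x => ?_
      simp [sub_mul, mul_sub, ζ]
    have h := h1.sub h2
    rw [sub_self] at h
    exact h
  have h := constant_of_has_deriv_right_zero hcont hderiv s (Set.right_mem_Icc.2 hts)
  have h0 : wickSum Z ζ .id (fun p => max 0 (min t p.time - t)) c w = 0 :=
    wickSum_zero fun p _ => max_eq_left (by linarith [min_le_left t p.time])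
  simp only [G, h0, mul_zero, map_zero, sub_zero] at h
  rw [sub_mul, mul_sub, map_sub, ← h]
  ring

theorem wickBelow (H : LevySystem τ Bfil Efam B EB η Z) (N : ℕ) :
    WickBelow Bfil Efam EB η Z N := by
  induction N with
  | zero => intro t _ w hw; simp at hw
  | succ N ih =>
    intro t ht w hwN hw s hts j c hc
    have hN : WickBelow Bfil Efam EB η Z w.length :=
      fun t' ht' v hv => ih t' ht' v (by omega)
    rw [← H.E_wickSum ht]
    refine H.ext_of_trace (Bfil t) (H.E_mem _ _) (H.E_mem _ _) fun b hb => ?_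
    rw [H.trace_mul_E hb, H.trace_mul_E hb, H.trace_increment_mul_word hN ht hw hts j hb hc]

theorem isSemicircularFamily (H : LevySystem τ Bfil Efam B EB η Z) {t : ℝ} (ht : 0 ≤ t) :
    IsSemicircularFamily (Efam t) (Bfil t)
      (fun p q : {s : ℝ // t ≤ s} × Fin n =>
        (((min (p.1 : ℝ) (q.1 : ℝ) - t : ℝ) : ℂ) • ((η p.2 q.2).comp EB)))
      (fun p : {s : ℝ // t ≤ s} × Fin n => Z (p.1 : ℝ) p.2 - Z t p.2) := by
  rintro ⟨⟨s, hs⟩, j⟩ b₀ b₁ w hb₀ hb₁ hw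
  have hw' : IsAdaptedWord (Bfil t : Set A) (w.map (incrementLetter Z t)) := by
    intro p hp
    obtain ⟨q, hq, rfl⟩ := List.mem_map.1 hp
    exact ⟨ht.trans q.1.1.2, H.adapted t ht _, hw q hq⟩
  simp only [wprod_eq_mul_evalWord]
  rw [mul_assoc, H.E_mul_left hb₀, H.wickBelow (w.length + 1) t ht _ (by simp) hw' s hs j b₁ hb₁,
    wickSum_map_incrementLetter _ _ hs, Finset.mul_sum]
  refine Finset.sum_congr rfl fun k _ => ?_
  simp only [LinearMap.smul_apply, LinearMap.comp_apply, H.EB_E ht, mul_smul_comm, smul_mul_assoc,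
    mul_assoc]

end LevySystem

end LevySystem

section Statement7

variable {A : Type*} [Ring A] [Algebra ℂ A] [StarRing A] [StarModule ℂ A]

/-- **Theorem 10 of the paper (free Paul Lévy theorem).**  Let `(A, τ)` be a tracial
noncommutative probability space (the elements of `A` are not assumed bounded: `A`
stands for an algebra of operators affiliated with a finite von Neumann algebra), with
an increasing filtration of (star sub)algebras `B_s`, `B ⊆ B_0`, with `τ`-preserving
conditional expectations `E_{B_s}`, and let `Z_s = (Z_s^1,…,Z_s^n)` be an `n`-tuple of
self-adjoint processes adapted to this filtration with `Z_0 = 0` such that: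
(1) `τ(Z_t | B_s) = Z_s` for `s ≤ t`;
(2) `Z_t − Z_s = U_{t,s} + V_{t,s}` with `τ(|U_{t,s}|⁴) ≤ K(t−s)^{3/2}` and
    `τ(|V_{t,s}|²) ≤ K(t−s)²`;
(3) `τ(Z_t^k A Z_t^l B) = τ(Z_s^k A Z_s^l B) + (t−s)τ(A η_{lk}(E_B(B))) + o(t−s)`
    for all `A, B ∈ B_s`.
Then `Z` is a `B`-free Brownian motion of covariance `η`. -/
theorem free_levy_theorem {n : ℕ}
    -- the trace
    (τ : A →ₗ[ℂ] ℂ) (hτ1 : τ 1 = 1) (hτtr : ∀ a b : A, τ (a * b) = τ (b * a))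
    (hτpos : ∀ a : A, 0 ≤ (τ (star a * a)).re ∧ (τ (star a * a)).im = 0)
    (hτfaithful : ∀ a : A, τ (star a * a) = 0 → a = 0)
    -- the filtration and its conditional expectations
    (Bfil : ℝ → StarSubalgebra ℂ A)
    (hmono : ∀ s t : ℝ, s ≤ t → (Bfil s : Set A) ⊆ (Bfil t : Set A))
    (Efam : ℝ → (A →ₗ[ℂ] A))
    (hEmem : ∀ s x, Efam s x ∈ Bfil s)
    (hEfix : ∀ s, ∀ x ∈ Bfil s, Efam s x = x)
    (hEbimod : ∀ s (a b : A), a ∈ Bfil s → b ∈ Bfil s → ∀ x,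
      Efam s (a * x * b) = a * Efam s x * b)
    (hEtrace : ∀ s x, τ (Efam s x) = τ x)
    (hEstar : ∀ s x, Efam s (star x) = star (Efam s x))
    -- the subalgebra `B ⊆ B_0` and its conditional expectation
    (B : StarSubalgebra ℂ A) (hB0 : (B : Set A) ⊆ (Bfil 0 : Set A))
    (EB : A →ₗ[ℂ] A) (hEBmem : ∀ x, EB x ∈ B) (hEBfix : ∀ x ∈ B, EB x = x)
    (hEBbimod : ∀ (a b : A), a ∈ B → b ∈ B → ∀ x, EB (a * x * b) = a * EB x * b)
    (hEBtrace : ∀ x, τ (EB x) = τ x)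
    -- the `τ`-symmetric completely positive covariance `η : B → M_n(B)`
    (η : Fin n → Fin n → (A →ₗ[ℂ] A))
    (hηB : ∀ i j, ∀ b ∈ B, η i j b ∈ B)
    (hηsymm : ∀ i j, ∀ x ∈ B, ∀ y ∈ B, τ (η i j x * y) = τ (x * η j i y))
    (hηpos : ∀ (x c : Fin n → A), (∀ i, x i ∈ B) → (∀ i, c i ∈ B) →
      0 ≤ (τ (∑ i, ∑ j, star (c i) * η i j (star (x i) * x j) * c j)).re)
    -- the adapted self-adjoint processes
    (Z : ℝ → Fin n → A)
    (hZ0 : ∀ j, Z 0 j = 0)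
    (hZsa : ∀ s, 0 ≤ s → ∀ j, star (Z s j) = Z s j)
    (hZad : ∀ s, 0 ≤ s → ∀ j, Z s j ∈ Bfil s)
    -- hypothesis (1): martingale property
    (h1 : ∀ s t : ℝ, 0 ≤ s → s ≤ t → ∀ j, Efam s (Z t j) = Z s j)
    -- hypothesis (2): decomposition of the increments
    (U V : ℝ → ℝ → Fin n → A) (K : ℝ)
    (h2 : ∀ s t : ℝ, 0 ≤ s → s ≤ t → ∀ j,
      Z t j - Z s j = U t s j + V t s j ∧
      (τ ((star (U t s j) * U t s j) * (star (U t s j) * U t s j))).re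
        ≤ K * (t - s) ^ ((3:ℝ)/2) ∧
      (τ (star (V t s j) * V t s j)).re ≤ K * (t - s) ^ 2)
    -- hypothesis (3): infinitesimal covariance
    (h3 : ∀ (s : ℝ), 0 ≤ s → ∀ (k l : Fin n) (a b : A), a ∈ Bfil s → b ∈ Bfil s →
      Tendsto (fun t : ℝ =>
          ‖τ (Z t k * a * Z t l * b) - τ (Z s k * a * Z s l * b)
            - ((t - s : ℝ) : ℂ) * τ (a * η l k (EB b))‖ / (t - s))
        (𝓝[>] s) (𝓝 0)) :
    IsBFreeBrownianMotion Efam (fun s => (Bfil s : Set A)) EB η Z := by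
  have H : LevySystem τ Bfil Efam B EB η Z :=
    { comm := hτtr, pos := hτpos, faithful := hτfaithful, mono := hmono, E_mem := hEmem,
      E_fix := hEfix, E_bimod := hEbimod, E_trace := hEtrace, base_le := hB0, EB_mem := hEBmem,
      EB_bimod := hEBbimod, EB_trace := hEBtrace, η_mem := hηB, η_symm := hηsymm, zero := hZ0,
      selfAdjoint := hZsa, adapted := hZad, martingale := h1, increment := ⟨U, V, K, h2⟩,
      covariance := h3 }
  exact ⟨hZ0, fun t ht j => ⟨hZad t ht j, hZsa t ht j⟩, fun t ht => H.isSemicircularFamily ht⟩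

end Statement7
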